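/- The limit of n^{-2} f^{(3)}(n;6,4) as n tends to infinity exists and equals 7/36. -/

import Mathlib

open Finset Filter

/-- An `r`-graph is `(s,k)`-free if it has no `k` distinct edges spanning at most `s` vertices. -/
def IsFree {V : Type*} [DecidableEq V] (G : Finset (Finset V)) (s k : ℕ) : Prop :=
  ¬ ∃ S ⊆ G, S.card = k ∧ (S.sup id).card ≤ s

/-- `exNum r n s k` is the maximum number of edges of an `(s,k)`-free `r`-uniform
hypergraph on `n` vertices, i.e. `f^{(r)}(n; s, k)`. -/
noncomputable def exNum (r n s k : ℕ) : ℕ :=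
  sSup {m : ℕ | ∃ G : Finset (Finset (Fin n)),
    (∀ e ∈ G, e.card = r) ∧ IsFree G s k ∧ G.card = m}

/-- A 3-graph avoiding four local patterns: three edges connected through shared pairs, two
diamonds with the same missing pair, a diamond with an edge on its missing pair and a further
edge meeting these five vertices twice, and the Pasch configuration. -/
structure Good {V : Type*} [DecidableEq V] (G : Finset (Finset V)) : Prop where
  card_eq : ∀ e ∈ G, e.card = 3
  not_chain : ∀ e₁ ∈ G, ∀ e₂ ∈ G, ∀ e₃ ∈ G, e₁ ≠ e₂ → e₂ ≠ e₃ → e₁ ≠ e₃ →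
    2 ≤ (e₁ ∩ e₂).card → 2 ≤ (e₂ ∩ e₃).card → False
  not_twin : ∀ e₁ ∈ G, ∀ e₂ ∈ G, ∀ e₃ ∈ G, ∀ e₄ ∈ G, e₁ ≠ e₂ → e₃ ≠ e₄ → e₁ ≠ e₃ → e₁ ≠ e₄ →
    2 ≤ (e₁ ∩ e₂).card → 2 ≤ (e₃ ∩ e₄).card → symmDiff e₁ e₂ = symmDiff e₃ e₄ → False
  not_fan : ∀ e₁ ∈ G, ∀ e₂ ∈ G, ∀ e₃ ∈ G, ∀ e₄ ∈ G, e₁ ≠ e₂ → e₁ ≠ e₃ → e₂ ≠ e₃ →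
    e₁ ≠ e₄ → e₂ ≠ e₄ → e₃ ≠ e₄ → 2 ≤ (e₁ ∩ e₂).card → symmDiff e₁ e₂ ⊆ e₃ →
    2 ≤ (e₄ ∩ (e₁ ∪ e₂ ∪ e₃)).card → False
  not_pasch : ∀ a b c d e f : V, {a, b, c} ∈ G → {a, d, e} ∈ G → {b, d, f} ∈ G →
    {c, e, f} ∈ G → a = f ∨ b = e ∨ c = d

section Triples

variable {V : Type*} [DecidableEq V]

lemma exists_diamond {e₁ e₂ : Finset V} (h₁ : e₁.card = 3) (h₂ : e₂.card = 3) (hne : e₁ ≠ e₂)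
    (h : 2 ≤ (e₁ ∩ e₂).card) : ∃ a b x y, e₁ = {a, b, x} ∧ e₂ = {a, b, y} ∧ a ≠ b ∧ a ≠ x ∧
      b ≠ x ∧ a ≠ y ∧ b ≠ y ∧ x ≠ y := by
  have h3 : (e₁ ∩ e₂).card ≠ 3 := by
    intro h3
    apply hne
    have e1 : e₁ ∩ e₂ = e₁ := eq_of_subset_of_card_le inter_subset_left (by omega)
    have e2 : e₁ ∩ e₂ = e₂ := eq_of_subset_of_card_le inter_subset_right (by omega)
    rw [← e1, e2]
  have h4 : (e₁ ∩ e₂).card ≤ 3 := h₁ ▸ card_le_card inter_subset_left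
  obtain ⟨a, b, hab, hi⟩ := card_eq_two.1 (show (e₁ ∩ e₂).card = 2 by omega)
  have k1 : (e₁ \ e₂).card = 1 := by
    have := card_sdiff_add_card_inter e₁ e₂; omega
  have k2 : (e₂ \ e₁).card = 1 := by
    have := card_sdiff_add_card_inter e₂ e₁; rw [inter_comm] at this; omega
  obtain ⟨x, hx⟩ := card_eq_one.1 k1
  obtain ⟨y, hy⟩ := card_eq_one.1 k2
  have ha : a ∈ e₁ ∩ e₂ := by simp [hi]
  have hb : b ∈ e₁ ∩ e₂ := by simp [hi]
  have hx' : x ∈ e₁ \ e₂ := by simp [hx]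
  have hy' : y ∈ e₂ \ e₁ := by simp [hy]
  simp only [mem_inter, Finset.mem_sdiff] at ha hb hx' hy'
  have E1 : e₁ = {a, b, x} := by
    rw [← sdiff_union_inter e₁ e₂, hx, hi]; ext; simp; tauto
  have E2 : e₂ = {a, b, y} := by
    rw [← sdiff_union_inter e₂ e₁, hy, inter_comm, hi]; ext; simp; tauto
  refine ⟨a, b, x, y, E1, E2, hab, ?_, ?_, ?_, ?_, ?_⟩ <;> rintro rfl <;> tauto

lemma symmDiff_diamond {a b x y : V} (ax : a ≠ x) (bx : b ≠ x) (ay : a ≠ y) (hby : b ≠ y)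
    (xy : x ≠ y) : symmDiff ({a, b, x} : Finset V) {a, b, y} = {x, y} := by
  ext v
  simp only [mem_symmDiff, mem_insert, mem_singleton]
  constructor
  · tauto
  · rintro (rfl | rfl)
    · left; refine ⟨by tauto, ?_⟩; rintro (h | h | h)
      · exact ax h.symm
      · exact bx h.symm
      · exact xy h
    · right; refine ⟨by tauto, ?_⟩; rintro (h | h | h)
      · exact ay h.symm
      · exact hby h.symm
      · exact xy h.symm

lemma card_inter_union_le {e₁ e₂ s : Finset V} (h₁ : e₁.card = 3) (h₂ : e₂.card = 3)
    (hne : e₁ ≠ e₂) (h : 2 ≤ (e₁ ∩ e₂).card) (hs₁ : (e₁ ∩ s).card ≤ 1) (hs₂ : (e₂ ∩ s).card ≤ 1)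
    (hs : ¬ symmDiff e₁ e₂ ⊆ s) : ((e₁ ∪ e₂) ∩ s).card ≤ 1 := by
  obtain ⟨a, b, x, y, rfl, rfl, ab, ax, bx, ay, hby, xy⟩ := exists_diamond h₁ h₂ hne h
  rw [symmDiff_diamond ax bx ay hby xy] at hs
  have : x ∉ s ∨ y ∉ s := by
    by_contra hc
    push Not at hc
    exact hs (by intro v; simp only [mem_insert, mem_singleton]; rintro (rfl | rfl) <;> tauto)
  rcases this with hx | hy
  · refine (card_le_card ?_).trans hs₂
    intro v
    simp only [mem_inter, mem_union, mem_insert, mem_singleton]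
    rintro ⟨_ , hv⟩
    have : v ≠ x := by rintro rfl; exact hx hv
    tauto
  · refine (card_le_card ?_).trans hs₁
    intro v
    simp only [mem_inter, mem_union, mem_insert, mem_singleton]
    rintro ⟨_ , hv⟩
    have : v ≠ y := by rintro rfl; exact hy hv
    tauto

lemma card_symmDiff_diamond {e₁ e₂ : Finset V} (h₁ : e₁.card = 3) (h₂ : e₂.card = 3)
    (hne : e₁ ≠ e₂) (h : 2 ≤ (e₁ ∩ e₂).card) :
    (symmDiff e₁ e₂).card = 2 ∧ (e₁ ∪ e₂).card = 4 ∧ (e₁ ∩ e₂).card = 2 := by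
  obtain ⟨a, b, x, y, rfl, rfl, ab, ax, bx, ay, hby, xy⟩ := exists_diamond h₁ h₂ hne h
  have hu : (({a, b, x} : Finset V) ∪ {a, b, y}).card = 4 := by
    have : ({a, b, x} : Finset V) ∪ {a, b, y} = {a, b, x, y} := by
      ext; simp only [mem_union, mem_insert, mem_singleton]; tauto
    rw [this, card_insert_of_notMem, card_insert_of_notMem, card_pair xy] <;> simp [*]
  refine ⟨?_, hu, ?_⟩
  · rw [symmDiff_diamond ax bx ay hby xy, card_pair xy]
  · have := card_union_add_card_inter ({a, b, x} : Finset V) {a, b, y}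
    omega

namespace Good

variable {G : Finset (Finset V)}

lemma seven_le_of_fan (hG : Good G) {e₁ e₂ e₃ e₄ : Finset V} (m₁ : e₁ ∈ G) (m₂ : e₂ ∈ G)
    (m₃ : e₃ ∈ G) (m₄ : e₄ ∈ G) (h12 : e₁ ≠ e₂) (h13 : e₁ ≠ e₃) (h14 : e₁ ≠ e₄) (h23 : e₂ ≠ e₃)
    (h24 : e₂ ≠ e₄) (h34 : e₃ ≠ e₄) (h : 2 ≤ (e₁ ∩ e₂).card) (hs : symmDiff e₁ e₂ ⊆ e₃) :
    7 ≤ (e₁ ∪ e₂ ∪ e₃ ∪ e₄).card := by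
  have c1 := hG.card_eq _ m₁
  have c2 := hG.card_eq _ m₂
  have c3 := hG.card_eq _ m₃
  have c4 := hG.card_eq _ m₄
  have h31 : (e₁ ∩ e₃).card ≤ 1 := by
    by_contra hc
    exact hG.not_chain _ m₂ _ m₁ _ m₃ h12.symm h13 h23 (by rwa [inter_comm]) (by omega)
  have h32 : (e₂ ∩ e₃).card ≤ 1 := by
    by_contra hc
    exact hG.not_chain _ m₁ _ m₂ _ m₃ h12 h23 h13 h (by omega)
  have h4 : (e₄ ∩ (e₁ ∪ e₂ ∪ e₃)).card ≤ 1 := by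
    by_contra hc
    exact hG.not_fan _ m₁ _ m₂ _ m₃ _ m₄ h12 h13 h23 h14 h24 h34 h hs (by omega)
  obtain ⟨-, hu, -⟩ := card_symmDiff_diamond c1 c2 h12 h
  have k1 : ((e₁ ∪ e₂) ∩ e₃).card ≤ 2 := by
    rw [union_inter_distrib_right]
    have := card_union_le (e₁ ∩ e₃) (e₂ ∩ e₃)
    omega
  have k2 := card_union_add_card_inter (e₁ ∪ e₂) e₃
  have k3 := card_union_add_card_inter (e₁ ∪ e₂ ∪ e₃) e₄
  rw [inter_comm _ e₄] at k3
  omega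

lemma seven_le_of_pair (hG : Good G) {e₁ e₂ e₃ e₄ : Finset V} (m₁ : e₁ ∈ G) (m₂ : e₂ ∈ G)
    (m₃ : e₃ ∈ G) (m₄ : e₄ ∈ G) (h12 : e₁ ≠ e₂) (h13 : e₁ ≠ e₃) (h14 : e₁ ≠ e₄) (h23 : e₂ ≠ e₃)
    (h24 : e₂ ≠ e₄) (h34 : e₃ ≠ e₄) (h : 2 ≤ (e₁ ∩ e₂).card) :
    7 ≤ (e₁ ∪ e₂ ∪ e₃ ∪ e₄).card := by
  have c1 := hG.card_eq _ m₁
  have c2 := hG.card_eq _ m₂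
  have c3 := hG.card_eq _ m₃
  have c4 := hG.card_eq _ m₄
  have far : ∀ e ∈ G, e₁ ≠ e → e₂ ≠ e → (e₁ ∩ e).card ≤ 1 ∧ (e₂ ∩ e).card ≤ 1 := by
    intro e m h1 h2
    constructor
    · by_contra hc
      exact hG.not_chain _ m₂ _ m₁ _ m h12.symm h1 h2 (by rwa [inter_comm]) (by omega)
    · by_contra hc
      exact hG.not_chain _ m₁ _ m₂ _ m h12 h2 h1 h (by omega)
  obtain ⟨f13, f23⟩ := far _ m₃ h13 h23
  obtain ⟨f14, f24⟩ := far _ m₄ h14 h24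
  by_cases s3 : symmDiff e₁ e₂ ⊆ e₃
  · exact hG.seven_le_of_fan m₁ m₂ m₃ m₄ h12 h13 h14 h23 h24 h34 h s3
  by_cases s4 : symmDiff e₁ e₂ ⊆ e₄
  · have := hG.seven_le_of_fan m₁ m₂ m₄ m₃ h12 h14 h13 h24 h23 h34.symm h s4
    rwa [union_assoc, union_comm e₄ e₃, ← union_assoc] at this
  have x3 := card_inter_union_le c1 c2 h12 h f13 f23 s3
  have x4 := card_inter_union_le c1 c2 h12 h f14 f24 s4
  obtain ⟨d2, hu, -⟩ := card_symmDiff_diamond c1 c2 h12 h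
  have tot := card_union_add_card_inter (e₁ ∪ e₂) (e₃ ∪ e₄)
  rw [← union_assoc] at tot
  have u34 := card_union_add_card_inter e₃ e₄
  have i34 : ((e₁ ∪ e₂) ∩ (e₃ ∪ e₄)).card ≤ 2 := by
    rw [inter_union_distrib_left]
    have := card_union_le ((e₁ ∪ e₂) ∩ e₃) ((e₁ ∪ e₂) ∩ e₄)
    omega
  by_cases h' : (e₃ ∩ e₄).card ≤ 1
  · omega
  have h'2 : 2 ≤ (e₃ ∩ e₄).card := by omega
  obtain ⟨d2', hu', -⟩ := card_symmDiff_diamond c3 c4 h34 h'2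
  have perm : ∀ s t : Finset V, s ∪ t = e₁ ∪ e₂ → e₃ ∪ e₄ ∪ s ∪ t = e₁ ∪ e₂ ∪ e₃ ∪ e₄ := by
    intro s t hst
    rw [union_assoc, hst, union_comm, ← union_assoc]
  by_cases s1 : symmDiff e₃ e₄ ⊆ e₁
  · have := hG.seven_le_of_fan m₃ m₄ m₁ m₂ h34 h13.symm h23.symm h14.symm h24.symm h12 h'2 s1
    rwa [perm _ _ rfl] at this
  by_cases s2 : symmDiff e₃ e₄ ⊆ e₂
  · have := hG.seven_le_of_fan m₃ m₄ m₂ m₁ h34 h23.symm h13.symm h24.symm h14.symm h12.symm h'2 s2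
    rwa [perm _ _ (union_comm _ _)] at this
  rw [inter_comm] at f13 f14 f23 f24
  have y1 := card_inter_union_le c3 c4 h34 h'2 f13 f14 s1
  have y2 := card_inter_union_le c3 c4 h34 h'2 f23 f24 s2
  by_contra hc
  have i2 : ((e₁ ∪ e₂) ∩ (e₃ ∪ e₄)).card = 2 := by omega
  have sub : symmDiff e₁ e₂ ⊆ e₃ ∪ e₄ := by
    by_contra hn
    have := card_inter_union_le c1 c2 h12 h (by rwa [inter_comm]) (by rwa [inter_comm]) hn
    omega
  have sub' : symmDiff e₃ e₄ ⊆ e₁ ∪ e₂ := by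
    by_contra hn
    have := card_inter_union_le c3 c4 h34 h'2 (by rwa [inter_comm]) (by rwa [inter_comm]) hn
    rw [inter_comm] at this
    omega
  have q1 : symmDiff e₁ e₂ = (e₁ ∪ e₂) ∩ (e₃ ∪ e₄) :=
    eq_of_subset_of_card_le (subset_inter (symmDiff_le_sup) sub) (by omega)
  have q2 : symmDiff e₃ e₄ = (e₁ ∪ e₂) ∩ (e₃ ∪ e₄) :=
    eq_of_subset_of_card_le (subset_inter sub' symmDiff_le_sup) (by omega)
  exact hG.not_twin _ m₁ _ m₂ _ m₃ _ m₄ h12 h34 h13 h14 h h'2 (q1.trans q2.symm)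

end Good

lemma inter_nonempty_of_linear {e₁ e₂ e₃ : Finset V} (c₁ : e₁.card = 3) (c₂ : e₂.card = 3)
    (c₃ : e₃.card = 3) (h13 : (e₁ ∩ e₃).card ≤ 1) (h23 : (e₂ ∩ e₃).card ≤ 1)
    (hU : (e₁ ∪ e₂ ∪ e₃).card ≤ 6) : (e₁ ∩ e₂).Nonempty := by
  rw [nonempty_iff_ne_empty]
  intro h0
  have k1 := card_union_add_card_inter e₁ e₂
  have k2 := card_union_add_card_inter (e₁ ∪ e₂) e₃
  rw [union_inter_distrib_right] at k2
  have := card_union_le (e₁ ∩ e₃) (e₂ ∩ e₃)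
  rw [h0, card_empty] at k1
  omega

lemma not_common_of_linear {e₁ e₂ e₃ : Finset V} (c₁ : e₁.card = 3) (c₂ : e₂.card = 3)
    (c₃ : e₃.card = 3) (h12 : (e₁ ∩ e₂).card ≤ 1) (h13 : (e₁ ∩ e₃).card ≤ 1)
    (h23 : (e₂ ∩ e₃).card ≤ 1) (hU : (e₁ ∪ e₂ ∪ e₃).card ≤ 6) {v : V} (m₁ : v ∈ e₁) (m₂ : v ∈ e₂)
    (m₃ : v ∈ e₃) : False := by
  have k1 := card_union_add_card_inter e₁ e₂
  have k2 := card_union_add_card_inter (e₁ ∪ e₂) e₃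
  have s13 : e₁ ∩ e₃ = {v} :=
    (eq_of_subset_of_card_le (by simp [m₁, m₃]) (by simpa using h13)).symm
  have s23 : e₂ ∩ e₃ = {v} :=
    (eq_of_subset_of_card_le (by simp [m₂, m₃]) (by simpa using h23)).symm
  rw [union_inter_distrib_right, s13, s23, union_self, card_singleton] at k2
  omega

lemma exists_pasch_of_linear {e₁ e₂ e₃ e₄ : Finset V} (c1 : e₁.card = 3) (c2 : e₂.card = 3)
    (c3 : e₃.card = 3) (c4 : e₄.card = 3) (i12 : (e₁ ∩ e₂).card ≤ 1) (i13 : (e₁ ∩ e₃).card ≤ 1)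
    (i14 : (e₁ ∩ e₄).card ≤ 1) (i23 : (e₂ ∩ e₃).card ≤ 1) (i24 : (e₂ ∩ e₄).card ≤ 1)
    (i34 : (e₃ ∩ e₄).card ≤ 1) (hU : (e₁ ∪ e₂ ∪ e₃ ∪ e₄).card ≤ 6) :
    ∃ a b c d e f, {a, b, c} = e₁ ∧ {a, d, e} = e₂ ∧ {b, d, f} = e₃ ∧ {c, e, f} = e₄ ∧
      a ≠ f ∧ b ≠ e ∧ c ≠ d := by
  have u123 : (e₁ ∪ e₂ ∪ e₃).card ≤ 6 :=
    (card_le_card (by intro; simp only [mem_union]; tauto)).trans hU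
  have u124 : (e₁ ∪ e₂ ∪ e₄).card ≤ 6 :=
    (card_le_card (by intro; simp only [mem_union]; tauto)).trans hU
  have u134 : (e₁ ∪ e₃ ∪ e₄).card ≤ 6 :=
    (card_le_card (by intro; simp only [mem_union]; tauto)).trans hU
  have u234 : (e₂ ∪ e₃ ∪ e₄).card ≤ 6 :=
    (card_le_card (by intro; simp only [mem_union]; tauto)).trans hU
  obtain ⟨a, ha⟩ := inter_nonempty_of_linear c1 c2 c3 i13 i23 u123
  obtain ⟨b, hb⟩ := inter_nonempty_of_linear c1 c3 c4 i14 i34 u134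
  obtain ⟨c, hc⟩ := inter_nonempty_of_linear c1 c4 c2 i12 (by rwa [inter_comm])
    (by rwa [union_right_comm])
  obtain ⟨d, hd⟩ := inter_nonempty_of_linear c2 c3 c4 i24 i34 u234
  obtain ⟨e, he⟩ := inter_nonempty_of_linear c2 c4 c3 i23 (by rwa [inter_comm])
    (by rwa [union_right_comm])
  obtain ⟨f, hf⟩ := inter_nonempty_of_linear c3 c4 c1 (by rwa [inter_comm]) (by rwa [inter_comm])
    (by rwa [union_comm, ← union_assoc])
  simp only [mem_inter] at ha hb hc hd he hf
  have n123 : ∀ v ∈ e₁, v ∈ e₂ → v ∈ e₃ → False :=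
    fun v => not_common_of_linear c1 c2 c3 i12 i13 i23 u123
  have n124 : ∀ v ∈ e₁, v ∈ e₂ → v ∈ e₄ → False :=
    fun v => not_common_of_linear c1 c2 c4 i12 i14 i24 u124
  have n134 : ∀ v ∈ e₁, v ∈ e₃ → v ∈ e₄ → False :=
    fun v => not_common_of_linear c1 c3 c4 i13 i14 i34 u134
  have n234 : ∀ v ∈ e₂, v ∈ e₃ → v ∈ e₄ → False :=
    fun v => not_common_of_linear c2 c3 c4 i23 i24 i34 u234
  have tri : ∀ (s : Finset V) (x y z : V), s.card = 3 → x ∈ s → y ∈ s → z ∈ s → x ≠ y → x ≠ z →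
      y ≠ z → ({x, y, z} : Finset V) = s := by
    intro s x y z hs hx hy hz xy xz yz
    apply eq_of_subset_of_card_le
    · intro v; simp only [mem_insert, mem_singleton]; rintro (rfl | rfl | rfl) <;> assumption
    · rw [hs, card_eq_three.2 ⟨x, y, z, xy, xz, yz, rfl⟩]
  have E1 : ({a, b, c} : Finset V) = e₁ := tri _ _ _ _ c1 ha.1 hb.1 hc.1
    (by rintro rfl; exact n123 _ ha.1 ha.2 hb.2) (by rintro rfl; exact n124 _ ha.1 ha.2 hc.2)
    (by rintro rfl; exact n134 _ hb.1 hb.2 hc.2)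
  have E2 : ({a, d, e} : Finset V) = e₂ := tri _ _ _ _ c2 ha.2 hd.1 he.1
    (by rintro rfl; exact n123 _ ha.1 ha.2 hd.2) (by rintro rfl; exact n124 _ ha.1 ha.2 he.2)
    (by rintro rfl; exact n234 _ hd.1 hd.2 he.2)
  have E3 : ({b, d, f} : Finset V) = e₃ := tri _ _ _ _ c3 hb.2 hd.2 hf.1
    (by rintro rfl; exact n123 _ hb.1 hd.1 hb.2) (by rintro rfl; exact n134 _ hb.1 hb.2 hf.2)
    (by rintro rfl; exact n234 _ hd.1 hd.2 hf.2)
  have E4 : ({c, e, f} : Finset V) = e₄ := tri _ _ _ _ c4 hc.2 he.2 hf.2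
    (by rintro rfl; exact n124 _ hc.1 he.1 hc.2) (by rintro rfl; exact n134 _ hc.1 hf.1 hc.2)
    (by rintro rfl; exact n234 _ he.1 hf.1 he.2)
  refine ⟨a, b, c, d, e, f, E1, E2, E3, E4, ?_, ?_, ?_⟩ <;> rintro rfl
  · exact n123 _ ha.1 ha.2 hf.1
  · exact n123 _ hb.1 he.1 hb.2
  · exact n124 _ hc.1 hd.1 hc.2

lemma Good.isFree {G : Finset (Finset V)} (hG : Good G) : IsFree G 6 4 := by
  rintro ⟨S, hS, hc, hU⟩
  obtain ⟨e₁, S', h1, rfl, hc'⟩ := card_eq_succ.1 hc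
  obtain ⟨e₂, e₃, e₄, h23, h24, h34, rfl⟩ := card_eq_three.1 hc'
  simp only [mem_insert, mem_singleton, not_or] at h1
  obtain ⟨h12, h13, h14⟩ : e₁ ≠ e₂ ∧ e₁ ≠ e₃ ∧ e₁ ≠ e₄ := h1
  have m₁ := hS (show e₁ ∈ _ by simp)
  have m₂ := hS (show e₂ ∈ _ by simp)
  have m₃ := hS (show e₃ ∈ _ by simp)
  have m₄ := hS (show e₄ ∈ _ by simp)
  have c1 := hG.card_eq _ m₁
  have c2 := hG.card_eq _ m₂
  have c3 := hG.card_eq _ m₃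
  have c4 := hG.card_eq _ m₄
  have hsup : (insert e₁ {e₂, e₃, e₄} : Finset (Finset V)).sup id = e₁ ∪ e₂ ∪ e₃ ∪ e₄ := by
    simp [sup_insert, union_assoc]
  rw [hsup] at hU
  have bound : ∀ a ∈ G, ∀ b ∈ G, ∀ c ∈ G, ∀ d ∈ G, a ≠ b → a ≠ c → a ≠ d → b ≠ c → b ≠ d → c ≠ d →
      a ∪ b ∪ c ∪ d = e₁ ∪ e₂ ∪ e₃ ∪ e₄ → (a ∩ b).card ≤ 1 := by
    intro a ma b mb c mc d md ab ac ad bc bd cd hu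
    by_contra hn
    have := hG.seven_le_of_pair ma mb mc md ab ac ad bc bd cd (by omega)
    rw [hu] at this
    omega
  have i12 := bound _ m₁ _ m₂ _ m₃ _ m₄ h12 h13 h14 h23 h24 h34 rfl
  have i13 := bound _ m₁ _ m₃ _ m₂ _ m₄ h13 h12 h14 h23.symm h34 h24 (by ac_rfl)
  have i14 := bound _ m₁ _ m₄ _ m₂ _ m₃ h14 h12 h13 h24.symm h34.symm h23 (by ac_rfl)
  have i23 := bound _ m₂ _ m₃ _ m₁ _ m₄ h23 h12.symm h24 h13.symm h34 h14 (by ac_rfl)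
  have i24 := bound _ m₂ _ m₄ _ m₁ _ m₃ h24 h12.symm h23 h14.symm h34.symm h13
    (by ac_rfl)
  have i34 := bound _ m₃ _ m₄ _ m₁ _ m₂ h34 h13.symm h23.symm h14.symm h24.symm h12
    (by ac_rfl)
  obtain ⟨a, b, c, d, e, f, rfl, rfl, rfl, rfl, h⟩ :=
    exists_pasch_of_linear c1 c2 c3 c4 i12 i13 i14 i23 i24 i34 hU
  rcases hG.not_pasch a b c d e f m₁ m₂ m₃ m₄ with h' | h' | h'
  exacts [h.1 h', h.2.1 h', h.2.2 h']

end Triples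

section Transport

variable {V W : Type*} [DecidableEq V] [DecidableEq W]

lemma Good.mono {G G' : Finset (Finset V)} (hG : Good G) (h : G' ⊆ G) : Good G' where
  card_eq e m := hG.card_eq e (h m)
  not_chain e₁ m₁ e₂ m₂ e₃ m₃ := hG.not_chain e₁ (h m₁) e₂ (h m₂) e₃ (h m₃)
  not_twin e₁ m₁ e₂ m₂ e₃ m₃ e₄ m₄ :=
    hG.not_twin e₁ (h m₁) e₂ (h m₂) e₃ (h m₃) e₄ (h m₄)
  not_fan e₁ m₁ e₂ m₂ e₃ m₃ e₄ m₄ :=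
    hG.not_fan e₁ (h m₁) e₂ (h m₂) e₃ (h m₃) e₄ (h m₄)
  not_pasch a b c d e f m₁ m₂ m₃ m₄ :=
    hG.not_pasch a b c d e f (h m₁) (h m₂) (h m₃) (h m₄)

lemma good_empty : Good (∅ : Finset (Finset V)) where
  card_eq e m := by simp at m
  not_chain e₁ m₁ := by simp at m₁
  not_twin e₁ m₁ := by simp at m₁
  not_fan e₁ m₁ := by simp at m₁
  not_pasch a b c d e f m₁ := by simp at m₁

lemma finset_map_symmDiff (φ : V ↪ W) (s t : Finset V) :
    (symmDiff s t).map φ = symmDiff (s.map φ) (t.map φ) := by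
  simp only [map_eq_image, image_symmDiff _ _ φ.injective]

lemma Good.map {G : Finset (Finset V)} (hG : Good G) (φ : V ↪ W) :
    Good (G.map (mapEmbedding φ).toEmbedding) where
  card_eq := by
    simp only [Finset.mem_map, RelEmbedding.coe_toEmbedding, mapEmbedding_apply]
    rintro _ ⟨e, m, rfl⟩
    rw [card_map, hG.card_eq e m]
  not_chain := by
    simp only [Finset.mem_map, RelEmbedding.coe_toEmbedding, mapEmbedding_apply]
    rintro _ ⟨e₁, m₁, rfl⟩ _ ⟨e₂, m₂, rfl⟩ _ ⟨e₃, m₃, rfl⟩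
    simp only [ne_eq, Finset.map_inj, ← map_inter, card_map]
    exact hG.not_chain _ m₁ _ m₂ _ m₃
  not_twin := by
    simp only [Finset.mem_map, RelEmbedding.coe_toEmbedding, mapEmbedding_apply]
    rintro _ ⟨e₁, m₁, rfl⟩ _ ⟨e₂, m₂, rfl⟩ _ ⟨e₃, m₃, rfl⟩ _ ⟨e₄, m₄, rfl⟩
    simp only [ne_eq, Finset.map_inj, ← map_inter, card_map, ← finset_map_symmDiff]
    exact hG.not_twin _ m₁ _ m₂ _ m₃ _ m₄
  not_fan := by
    simp only [Finset.mem_map, RelEmbedding.coe_toEmbedding, mapEmbedding_apply]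
    rintro _ ⟨e₁, m₁, rfl⟩ _ ⟨e₂, m₂, rfl⟩ _ ⟨e₃, m₃, rfl⟩ _ ⟨e₄, m₄, rfl⟩
    simp only [ne_eq, Finset.map_inj, ← map_inter, card_map, ← finset_map_symmDiff, ← map_union,
      map_subset_map]
    exact hG.not_fan _ m₁ _ m₂ _ m₃ _ m₄
  not_pasch := by
    intro a b c d e f
    simp only [Finset.mem_map, RelEmbedding.coe_toEmbedding, mapEmbedding_apply]
    rintro ⟨e₁, m₁, h₁⟩ ⟨e₂, m₂, h₂⟩ ⟨e₃, m₃, h₃⟩ ⟨e₄, m₄, h₄⟩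
    have pull : ∀ (s : Finset V) (t : Finset W), s.map φ = t → ∀ v ∈ t, ∃ u, φ u = v := by
      rintro s _ rfl v hv
      obtain ⟨u, -, h⟩ := Finset.mem_map.1 hv
      exact ⟨u, h⟩
    obtain ⟨a, rfl⟩ := pull _ _ h₁ a (by simp)
    obtain ⟨b, rfl⟩ := pull _ _ h₁ b (by simp)
    obtain ⟨c, rfl⟩ := pull _ _ h₁ c (by simp)
    obtain ⟨d, rfl⟩ := pull _ _ h₂ d (by simp)
    obtain ⟨e, rfl⟩ := pull _ _ h₂ e (by simp)
    obtain ⟨f, rfl⟩ := pull _ _ h₃ f (by simp)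
    have back : ∀ (s : Finset V) (x y z : V), s.map φ = {φ x, φ y, φ z} → s = {x, y, z} := by
      intro s x y z h
      apply map_injective φ
      rw [h]
      simp [map_insert]
    rw [back _ _ _ _ h₁] at m₁
    rw [back _ _ _ _ h₂] at m₂
    rw [back _ _ _ _ h₃] at m₃
    rw [back _ _ _ _ h₄] at m₄
    simpa only [φ.injective.eq_iff] using hG.not_pasch a b c d e f m₁ m₂ m₃ m₄

end Transport

section Glue

variable {V K : Type*} [DecidableEq V]

lemma exists_two_of_two_le_card {V : Type*} {s : Finset V} (h : 2 ≤ s.card) :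
    ∃ u ∈ s, ∃ v ∈ s, u ≠ v := by
  obtain ⟨u, hu, v, hv, h⟩ := one_lt_card.1 h
  exact ⟨u, hu, v, hv, h⟩

lemma symmDiff_subset (s t : Finset V) : symmDiff s t ⊆ s ∪ t := symmDiff_le_sup

/-- A transversal good hypergraph stays good when good hypergraphs are added inside the fibres. -/
lemma Good.glue [Fintype K] [DecidableEq K] (π : V → K) {H : Finset (Finset V)}
    {L : K → Finset (Finset V)} (hH : Good H) (hL : ∀ k, Good (L k))
    (inj : ∀ e ∈ H, ∀ u ∈ e, ∀ v ∈ e, π u = π v → u = v)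
    (mono : ∀ k, ∀ e ∈ L k, ∀ v ∈ e, π v = k)
    (hpasch : ∀ a b c d e f, π a = π b → π b = π c → {a, d, e} ∈ H → {b, d, f} ∈ H →
      {c, e, f} ∈ H → a ≠ b → a ≠ c → b ≠ c → False)
    (hdiam : ∀ e₁ ∈ H, ∀ e₂ ∈ H, e₁ ≠ e₂ → 2 ≤ (e₁ ∩ e₂).card →
      ∀ u ∈ e₁ ∪ e₂, ∀ v ∈ e₁ ∪ e₂, π u = π v → u = v)
    (hfan : ∀ e₁ ∈ H, ∀ e₂ ∈ H, ∀ e₃ ∈ H, e₁ ≠ e₂ → e₁ ≠ e₃ → e₂ ≠ e₃ → 2 ≤ (e₁ ∩ e₂).card →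
      symmDiff e₁ e₂ ⊆ e₃ → ∀ u ∈ e₁ ∪ e₂ ∪ e₃, ∀ v ∈ e₁ ∪ e₂ ∪ e₃, π u = π v → u = v) :
    Good (H ∪ univ.biUnion L) := by
  have split : ∀ e, e ∈ H ∪ univ.biUnion L → e ∈ H ∨ ∃ k, e ∈ L k := by
    intro e he
    simpa using he
  have card3 : ∀ e ∈ H ∪ univ.biUnion L, e.card = 3 := by
    intro e he
    rcases split e he with h | ⟨k, h⟩
    exacts [hH.card_eq e h, (hL k).card_eq e h]
  have toL : ∀ k e, e ∈ H ∪ univ.biUnion L → ∀ u ∈ e, ∀ v ∈ e, u ≠ v → π u = k → π v = k →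
      e ∈ L k := by
    intro k e he u hu v hv huv hk hk'
    rcases split e he with h | ⟨k', h⟩
    · exact absurd (inj e h u hu v hv (hk.trans hk'.symm)) huv
    · rwa [← hk, mono k' e h u hu]
  have toH : ∀ e, e ∈ H ∪ univ.biUnion L → ∀ u ∈ e, ∀ v ∈ e, π u ≠ π v → e ∈ H := by
    intro e he u hu v hv huv
    rcases split e he with h | ⟨k', h⟩
    · exact h
    · exact absurd ((mono k' e h u hu).trans (mono k' e h v hv).symm) huv
  have link : ∀ e e', e ∈ H ∪ univ.biUnion L → e' ∈ H ∪ univ.biUnion L → 2 ≤ (e ∩ e').card →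
      (e ∈ H → e' ∈ H) ∧ (∀ k, e ∈ L k → e' ∈ L k) := by
    intro e e' he he' h
    obtain ⟨u, hu, v, hv, huv⟩ := exists_two_of_two_le_card h
    simp only [mem_inter] at hu hv
    refine ⟨fun m => toH e' he' u hu.2 v hv.2 fun h => huv (inj e m u hu.1 v hv.1 h), ?_⟩
    intro k m
    exact toL k e' he' u hu.2 v hv.2 huv (mono k e m u hu.1) (mono k e m v hv.1)
  have img : ∀ a b k, a ∈ L k → b ∈ L k → ∀ w ∈ symmDiff a b, π w = k := by
    intro a b k ha hb w hw
    rcases mem_symmDiff.1 hw with ⟨hw, -⟩ | ⟨hw, -⟩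
    exacts [mono k _ ha w hw, mono k _ hb w hw]
  have missing : ∀ e₁ e₂, e₁ ∈ H ∪ univ.biUnion L → e₂ ∈ H ∪ univ.biUnion L →
      e₁ ≠ e₂ → 2 ≤ (e₁ ∩ e₂).card → ∃ u ∈ symmDiff e₁ e₂, ∃ v ∈ symmDiff e₁ e₂, u ≠ v ∧
      (e₁ ∈ H ∧ e₂ ∈ H ∧ π u ≠ π v ∨ ∃ k, e₁ ∈ L k ∧ e₂ ∈ L k ∧ π u = k ∧ π v = k) := by
    intro e₁ e₂ m₁ m₂ hne h
    obtain ⟨d2, -, -⟩ := card_symmDiff_diamond (card3 _ m₁) (card3 _ m₂) hne h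
    obtain ⟨u, hu, v, hv, huv⟩ := exists_two_of_two_le_card d2.ge
    refine ⟨u, hu, v, hv, huv, ?_⟩
    rcases split _ m₁ with h₁ | ⟨k, h₁⟩
    · have h₂ := (link _ _ m₁ m₂ h).1 h₁
      exact Or.inl ⟨h₁, h₂, fun hh => huv (hdiam _ h₁ _ h₂ hne h u (symmDiff_subset _ _ hu) v
        (symmDiff_subset _ _ hv) hh)⟩
    · have h₂ := (link _ _ m₁ m₂ h).2 k h₁
      exact Or.inr ⟨k, h₁, h₂, img _ _ k h₁ h₂ u hu, img _ _ k h₁ h₂ v hv⟩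
  have disj : ∀ e k, e ∈ H → e ∈ L k → False := by
    intro e k h h'
    obtain ⟨u, hu, v, hv, huv⟩ := exists_two_of_two_le_card (s := e)
      (by have := hH.card_eq e h; omega)
    exact huv (inj e h u hu v hv ((mono k e h' u hu).trans (mono k e h' v hv).symm))
  refine ⟨card3, ?_, ?_, ?_, ?_⟩
  · intro e₁ m₁ e₂ m₂ e₃ m₃ h12 h23 h13 i12 i23
    rcases split _ m₁ with h₁ | ⟨k, h₁⟩
    · have h₂ := (link _ _ m₁ m₂ i12).1 h₁
      have h₃ := (link _ _ m₂ m₃ i23).1 h₂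
      exact hH.not_chain _ h₁ _ h₂ _ h₃ h12 h23 h13 i12 i23
    · have h₂ := (link _ _ m₁ m₂ i12).2 k h₁
      have h₃ := (link _ _ m₂ m₃ i23).2 k h₂
      exact (hL k).not_chain _ h₁ _ h₂ _ h₃ h12 h23 h13 i12 i23
  · intro e₁ m₁ e₂ m₂ e₃ m₃ e₄ m₄ h12 h34 h13 h14 i12 i34 hs
    obtain ⟨u, hu, v, hv, huv, hc⟩ := missing _ _ m₁ m₂ h12 i12
    have hu' := hs ▸ hu
    have hv' := hs ▸ hv
    rcases split _ m₃ with h₃ | ⟨k', h₃⟩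
    · have h₄ := (link _ _ m₃ m₄ i34).1 h₃
      have huv' : π u ≠ π v := fun h => huv (hdiam _ h₃ _ h₄ h34 i34 u (symmDiff_subset _ _ hu') v
        (symmDiff_subset _ _ hv') h)
      rcases hc with ⟨h₁, h₂, -⟩ | ⟨k, -, -, h, h'⟩
      · exact hH.not_twin _ h₁ _ h₂ _ h₃ _ h₄ h12 h34 h13 h14 i12 i34 hs
      · exact huv' (h.trans h'.symm)
    · have h₄ := (link _ _ m₃ m₄ i34).2 k' h₃
      have pu := img _ _ k' h₃ h₄ u hu'
      have pv := img _ _ k' h₃ h₄ v hv'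
      rcases hc with ⟨-, -, h⟩ | ⟨k, h₁, h₂, h, -⟩
      · exact h (pu.trans pv.symm)
      · obtain rfl : k = k' := h.symm.trans pu
        exact (hL k).not_twin _ h₁ _ h₂ _ h₃ _ h₄ h12 h34 h13 h14 i12 i34 hs
  · intro e₁ m₁ e₂ m₂ e₃ m₃ e₄ m₄ h12 h13 h23 h14 h24 h34 i12 hs i4
    obtain ⟨x, hx, y, hy, hxy, hc⟩ := missing _ _ m₁ m₂ h12 i12
    obtain ⟨u, hu, v, hv, huv⟩ := exists_two_of_two_le_card i4
    simp only [mem_inter] at hu hv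
    rcases hc with ⟨h₁, h₂, hπ⟩ | ⟨k, h₁, h₂, px, py⟩
    · have h₃ := toH e₃ m₃ x (hs hx) y (hs hy) hπ
      have h₄ := toH e₄ m₄ u hu.1 v hv.1
        fun h => huv (hfan _ h₁ _ h₂ _ h₃ h12 h13 h23 i12 hs u hu.2 v hv.2 h)
      exact hH.not_fan _ h₁ _ h₂ _ h₃ _ h₄ h12 h13 h23 h14 h24 h34 i12 hs i4
    · have h₃ := toL k e₃ m₃ x (hs hx) y (hs hy) hxy px py
      have all : ∀ w ∈ e₁ ∪ e₂ ∪ e₃, π w = k := by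
        intro w hw
        simp only [mem_union] at hw
        rcases hw with (hw | hw) | hw
        exacts [mono k _ h₁ w hw, mono k _ h₂ w hw, mono k _ h₃ w hw]
      have h₄ := toL k e₄ m₄ u hu.1 v hv.1 huv (all u hu.2) (all v hv.2)
      exact (hL k).not_fan _ h₁ _ h₂ _ h₃ _ h₄ h12 h13 h23 h14 h24 h34 i12 hs i4
  · have ne3 : ∀ x y z : V, ({x, y, z} : Finset V) ∈ H ∪ univ.biUnion L →
        x ≠ y ∧ x ≠ z ∧ y ≠ z := by
      intro x y z m
      have hc := card3 _ m
      refine ⟨?_, ?_, ?_⟩ <;> rintro rfl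
      · have := card_le_two (a := x) (b := z)
        simp only [insert_idem] at hc; omega
      · have := card_le_two (a := x) (b := y)
        rw [insert_comm x y, insert_eq_of_mem (by simp : x ∈ ({x} : Finset V)),
          pair_comm] at hc; omega
      · have := card_le_two (a := x) (b := y)
        rw [insert_eq_of_mem (by simp : y ∈ ({y} : Finset V))] at hc; omega
    have key : ∀ a b c d e f k, {a, b, c} ∈ H ∪ univ.biUnion L → {a, d, e} ∈ H ∪ univ.biUnion L →
        {b, d, f} ∈ H ∪ univ.biUnion L → {c, e, f} ∈ H ∪ univ.biUnion L → {a, b, c} ∈ L k →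
        {a, d, e} ∈ L k ∧ {b, d, f} ∈ L k ∧ {c, e, f} ∈ L k := by
      intro a b c d e f k m₁ m₂ m₃ m₄ h₁
      have pa := mono k _ h₁ a (by simp)
      have pb := mono k _ h₁ b (by simp)
      have pc := mono k _ h₁ c (by simp)
      obtain ⟨n1, n2, n3⟩ := ne3 _ _ _ m₁
      obtain ⟨n4, n5, n6⟩ := ne3 _ _ _ m₂
      obtain ⟨n7, n8, n9⟩ := ne3 _ _ _ m₃
      obtain ⟨n10, n11, n12⟩ := ne3 _ _ _ m₄
      rcases split _ m₂ with h₂ | ⟨k', h₂⟩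
      · exfalso
        rcases split _ m₃ with h₃ | ⟨k', h₃⟩
        · rcases split _ m₄ with h₄ | ⟨k', h₄⟩
          · exact hpasch a b c d e f (pa.trans pb.symm) (pb.trans pc.symm) h₂ h₃ h₄ n1 n2 n3
          · have hk : k' = k := (mono k' _ h₄ c (by simp)).symm.trans pc
            exact n5 (inj _ h₂ a (by simp) e (by simp)
              (pa.trans (hk ▸ (mono k' _ h₄ e (by simp)).symm)))
        · have hk : k' = k := (mono k' _ h₃ b (by simp)).symm.trans pb
          exact n4 (inj _ h₂ a (by simp) d (by simp)
            (pa.trans (hk ▸ (mono k' _ h₃ d (by simp)).symm)))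
      · obtain rfl : k' = k := (mono k' _ h₂ a (by simp)).symm.trans pa
        exact ⟨h₂, toL k' _ m₃ b (by simp) d (by simp) n7 pb (mono k' _ h₂ d (by simp)),
          toL k' _ m₄ c (by simp) e (by simp) n10 pc (mono k' _ h₂ e (by simp))⟩
    intro a b c d e f m₁ m₂ m₃ m₄
    rcases split _ m₁ with h₁ | ⟨k, h₁⟩
    · have sw : ∀ x y z : V, ({x, y, z} : Finset V) = {y, x, z} := fun x y z => insert_comm x y {z}
      have rot : ∀ x y z : V, ({x, y, z} : Finset V) = {z, x, y} := by
        intro x y z; rw [pair_comm, insert_comm]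
      rcases split _ m₂ with h₂ | ⟨k, h₂⟩
      · rcases split _ m₃ with h₃ | ⟨k, h₃⟩
        · rcases split _ m₄ with h₄ | ⟨k, h₄⟩
          · exact hH.not_pasch a b c d e f h₁ h₂ h₃ h₄
          · have := (key c e f a b d k m₄ (by rwa [rot] at m₁)
              (by rwa [rot] at m₂) (by rwa [rot] at m₃) h₄).1
            rw [← rot] at this
            exact (disj _ k h₁ this).elim
        · exact (disj _ k h₁ (sw b a c ▸ (key b d f a c e k m₃ (sw a b c ▸ m₁) (sw a d e ▸ m₂)
            (by rwa [rot] at m₄) h₃).1)).elim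
      · exact (disj _ k h₁ (key a d e b c f k m₂ m₁ (sw b d f ▸ m₃) (sw c e f ▸ m₄) h₂).1).elim
    · obtain ⟨h₂, h₃, h₄⟩ := key a b c d e f k m₁ m₂ m₃ m₄ h₁
      exact (hL k).not_pasch a b c d e f h₁ h₂ h₃ h₄

end Glue

section Base

/-- The seven triples of the base configuration. -/
def baseTriples : Finset (Finset (Fin 9)) :=
  {{0, 1, 2}, {3, 4, 0}, {3, 4, 1}, {5, 6, 1}, {5, 6, 2}, {7, 8, 0}, {7, 8, 2}}

/-- Labels of the base vertices; differences along base triples are pairwise distinct. -/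
def lab : Fin 9 → ZMod 37 := ![0, 1, 6, 13, 30, 4, 27, 15, 33]

/-- Two colourings of the base vertices, both injective on every base triple. -/
def baseColour : Fin 2 → Fin 9 → Fin 4 :=
  ![![0, 1, 2, 2, 3, 0, 3, 1, 3], ![0, 1, 2, 3, 2, 3, 0, 3, 1]]

/-- Two distinct base vertices are adjacent when some base triple contains both. -/
def BaseAdj (i j : Fin 9) : Prop := i ≠ j ∧ ∃ f ∈ baseTriples, i ∈ f ∧ j ∈ f

instance : DecidableRel BaseAdj := fun i j => by unfold BaseAdj; infer_instance

lemma lab_injective : Function.Injective lab := by decide +kernel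

lemma lab_sub_inj : ∀ i j i' j', BaseAdj i j → BaseAdj i' j' → lab j - lab i = lab j' - lab i' →
    i = i' ∧ j = j' := by decide +kernel

lemma baseColour_ne : ∀ t i j, BaseAdj i j → baseColour t i ≠ baseColour t j := by decide +kernel

lemma baseTriples_card : ∀ f ∈ baseTriples, f.card = 3 := by decide +kernel

lemma baseTriples_not_chain : ∀ e₁ ∈ baseTriples, ∀ e₂ ∈ baseTriples, ∀ e₃ ∈ baseTriples,
    e₁ ≠ e₂ → e₂ ≠ e₃ → e₁ ≠ e₃ → 2 ≤ (e₁ ∩ e₂).card → 2 ≤ (e₂ ∩ e₃).card → False := by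
  decide +kernel

set_option synthInstance.maxHeartbeats 400000 in
set_option synthInstance.maxSize 1000 in
lemma baseTriples_not_twin : ∀ e₁ ∈ baseTriples, ∀ e₂ ∈ baseTriples, ∀ e₃ ∈ baseTriples,
    ∀ e₄ ∈ baseTriples, e₁ ≠ e₂ → e₃ ≠ e₄ → e₁ ≠ e₃ → e₁ ≠ e₄ → 2 ≤ (e₁ ∩ e₂).card →
    2 ≤ (e₃ ∩ e₄).card → symmDiff e₁ e₂ = symmDiff e₃ e₄ → False := by
  decide +kernel

set_option synthInstance.maxHeartbeats 400000 in
set_option synthInstance.maxSize 1000 in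
lemma baseTriples_not_fan : ∀ e₁ ∈ baseTriples, ∀ e₂ ∈ baseTriples, ∀ e₃ ∈ baseTriples,
    ∀ e₄ ∈ baseTriples, e₁ ≠ e₂ → e₁ ≠ e₃ → e₂ ≠ e₃ → e₁ ≠ e₄ → e₂ ≠ e₄ → e₃ ≠ e₄ →
    2 ≤ (e₁ ∩ e₂).card → symmDiff e₁ e₂ ⊆ e₃ → 2 ≤ (e₄ ∩ (e₁ ∪ e₂ ∪ e₃)).card → False := by
  decide +kernel

lemma baseAdj_of_mem_symmDiff : ∀ e₁ ∈ baseTriples, ∀ e₂ ∈ baseTriples, e₁ ≠ e₂ →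
    2 ≤ (e₁ ∩ e₂).card → ∀ i ∈ symmDiff e₁ e₂, ∀ j ∈ symmDiff e₁ e₂, i ≠ j → BaseAdj i j := by
  decide +kernel

set_option synthInstance.maxHeartbeats 400000 in
set_option synthInstance.maxSize 1000 in
lemma baseAdj_or_of_fan : ∀ e₁ ∈ baseTriples, ∀ e₂ ∈ baseTriples, ∀ e₃ ∈ baseTriples,
    e₁ ≠ e₂ → e₁ ≠ e₃ → e₂ ≠ e₃ → 2 ≤ (e₁ ∩ e₂).card → symmDiff e₁ e₂ ⊆ e₃ →
    ∀ i ∈ e₁ ∪ e₂ ∪ e₃, ∀ j ∈ e₁ ∪ e₂ ∪ e₃, i ≠ j →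
    BaseAdj i j ∨ ∃ t, baseColour t i = baseColour t j := by
  decide +kernel

lemma baseTriples_no_three_on_four : ∀ i j l n, {i, j, l} ∈ baseTriples →
    {i, j, n} ∈ baseTriples → {i, l, n} ∈ baseTriples → False := by
  decide +kernel

/-- Coefficients of the four linear forms attached to the colours. -/
def formCoeff : Fin 4 → ℤ × ℤ := ![(1, 0), (0, 1), (1, 1), (1, 3)]

/-- The determinant of two of the linear forms. -/
def formDet (c c' : Fin 4) : ℤ :=
  (formCoeff c).1 * (formCoeff c').2 - (formCoeff c').1 * (formCoeff c).2

lemma formDet_dvd : ∀ c c', c ≠ c' → formDet c c' ∣ 30 := by decide +kernel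

lemma formDiff_dvd : ∀ c c', c ≠ c' → ((formCoeff c).1 - (formCoeff c').1) -
    ((formCoeff c).2 - (formCoeff c').2) ∣ 30 := by decide +kernel

lemma formDet_pasch_dvd : ∀ t i j l l', {i, j, l} ∈ baseTriples → {i, j, l'} ∈ baseTriples →
    formDet (baseColour t j) (baseColour t l) * formDet (baseColour t l') (baseColour t i) +
    formDet (baseColour t l) (baseColour t i) * formDet (baseColour t j) (baseColour t l') ∣
    30 ^ 3 := by decide +kernel

end Base

/-- Pairs of label differences seen from a vertex of a base triple. -/
def diffPairs : List (ℕ × ℕ) :=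
  [(1, 6), (6, 1), (36, 5), (5, 36), (31, 32), (32, 31), (17, 24), (24, 17), (20, 7), (7, 20),
    (13, 30), (30, 13), (17, 25), (25, 17), (20, 8), (8, 20), (12, 29), (29, 12), (23, 34),
    (34, 23), (14, 11), (11, 14), (3, 26), (26, 3), (23, 2), (2, 23), (14, 16), (16, 14),
    (35, 21), (21, 35), (18, 22), (22, 18), (19, 4), (4, 19), (15, 33), (33, 15), (18, 28),
    (28, 18), (19, 10), (10, 19), (9, 27), (27, 9)]


lemma mem_diffPairs : ∀ i j l, {i, j, l} ∈ baseTriples →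
    ∃ s ∈ diffPairs, lab j - lab i = (s.1 : ℕ) ∧ lab l - lab i = (s.2 : ℕ) := by decide +kernel

lemma diffPairs_all : (diffPairs.all fun s => diffPairs.all fun t => diffPairs.all fun u =>
    !(Nat.beq ((u.1 + s.1) % 37) (t.1 % 37)) || diffPairs.all fun v =>
    !(Nat.beq ((v.1 + s.2) % 37) (t.2 % 37)) ||
    (!(Nat.beq ((v.2 + s.2) % 37) ((s.1 + u.2) % 37)) ||
    ((Nat.beq ((s.1 + u.2) % 37) 0 && Nat.beq s.1 t.2) ||
    ((Nat.beq ((s.1 + u.2) % 37) 0 && Nat.beq s.2 t.1) ||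
    (Nat.beq s.1 t.2 && Nat.beq s.2 t.1))))) = true := by
  decide +kernel

lemma diffPairs_pasch : ∀ s ∈ diffPairs, ∀ t ∈ diffPairs, ∀ u ∈ diffPairs, ∀ v ∈ diffPairs,
    ((u.1 : ℕ) : ZMod 37) = t.1 - s.1 → ((v.1 : ℕ) : ZMod 37) = t.2 - s.2 →
    ((v.2 : ℕ) : ZMod 37) = s.1 + u.2 - s.2 →
    (s.1 + u.2 : ZMod 37) = 0 ∧ (s.1 : ZMod 37) = t.2 ∨
    (s.1 + u.2 : ZMod 37) = 0 ∧ (s.2 : ZMod 37) = t.1 ∨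
    (s.1 : ZMod 37) = t.2 ∧ (s.2 : ZMod 37) = t.1 := by
  intro s hs t ht u hu v hv h₁ h₂ h₃
  have h := diffPairs_all
  simp only [List.all_eq_true] at h
  have h := h s hs t ht u hu
  have g₁ : (u.1 + s.1) % 37 = t.1 % 37 := by
    rw [← ZMod.natCast_eq_natCast_iff']; push_cast; rw [h₁]; ring
  have g₂ : (v.1 + s.2) % 37 = t.2 % 37 := by
    rw [← ZMod.natCast_eq_natCast_iff']; push_cast; rw [h₂]; ring
  have g₃ : (v.2 + s.2) % 37 = (s.1 + u.2) % 37 := by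
    rw [← ZMod.natCast_eq_natCast_iff']; push_cast; rw [h₃]; ring
  have z : (s.1 + u.2) % 37 = 0 → (s.1 + u.2 : ZMod 37) = 0 := by
    intro h
    rw [← Nat.cast_add, ZMod.natCast_eq_zero_iff]
    exact Nat.dvd_of_mod_eq_zero h
  simp only [g₁, Nat.beq_refl, Bool.not_true, Bool.false_or, List.all_eq_true] at h
  have h := h v hv
  simp only [g₂, g₃, Nat.beq_refl, Bool.not_true, Bool.false_or, Bool.or_eq_true,
    Bool.and_eq_true, Nat.beq_eq] at h
  rcases h with ⟨a, b⟩ | ⟨a, b⟩ | ⟨a, b⟩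
  · exact Or.inl ⟨z a, by rw [b]⟩
  · exact Or.inr (Or.inl ⟨z a, by rw [b]⟩)
  · exact Or.inr (Or.inr ⟨by rw [a], by rw [b]⟩)

section Transversal

variable {R : Type*} [CommRing R]

/-- The linear form on `R × R` attached to a colour. -/
def form (c : Fin 4) (p : R × R) : R := (formCoeff c).1 * p.1 + (formCoeff c).2 * p.2

lemma formDet_mul_fst (c c' : Fin 4) (p : R × R) :
    (formDet c c' : R) * p.1 = (formCoeff c').2 * form c p - (formCoeff c).2 * form c' p := by
  simp only [formDet, form]; push_cast; ring

lemma formDet_mul_snd (c c' : Fin 4) (p : R × R) :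
    (formDet c c' : R) * p.2 = (formCoeff c).1 * form c' p - (formCoeff c').1 * form c p := by
  simp only [formDet, form]; push_cast; ring

lemma formDet_plucker (c c' c'' : Fin 4) (p : R × R) :
    (formDet c' c'' : R) * form c p + formDet c'' c * form c' p + formDet c c' * form c'' p = 0 := by
  simp only [formDet, form]; push_cast; ring

lemma isUnit_intCast_of_dvd (h30 : IsUnit (30 : R)) {d : ℤ} {n : ℕ} (hd : d ∣ 30 ^ n) :
    IsUnit (d : R) := by
  have h := map_dvd (Int.castRingHom R) hd
  simp only [eq_intCast] at h
  refine isUnit_of_dvd_unit h ?_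
  push_cast
  exact h30.pow n

lemma form_inj (h30 : IsUnit (30 : R)) {c c' : Fin 4} (hc : c ≠ c') {p p' : R × R}
    (h : form c p = form c p') (h' : form c' p = form c' p') : p = p' := by
  have hu : IsUnit (formDet c c' : R) :=
    isUnit_intCast_of_dvd (n := 1) h30 (by simpa using formDet_dvd c c' hc)
  apply Prod.ext
  · apply hu.mul_left_cancel
    rw [formDet_mul_fst, formDet_mul_fst, h, h']
  · apply hu.mul_left_cancel
    rw [formDet_mul_snd, formDet_mul_snd, h', h]

/-- The vertex with base index `i` in the copy of the base configuration given by `k`, `p`, `q`. -/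
def vtx (x : ZMod 37 × (R × R) × (R × R)) (i : Fin 9) : ZMod 37 × R × R :=
  (x.1 + lab i, form (baseColour 0 i) x.2.1, form (baseColour 1 i) x.2.2)

lemma vtx_fst_injective (x : ZMod 37 × (R × R) × (R × R)) {i j : Fin 9}
    (h : (vtx x i).1 = (vtx x j).1) : i = j :=
  lab_injective (add_left_cancel h)

/-- A copy of the base configuration. -/
def copyEmb (x : ZMod 37 × (R × R) × (R × R)) : Fin 9 ↪ ZMod 37 × R × R :=
  ⟨vtx x, fun _ _ h => vtx_fst_injective x (congrArg Prod.fst h)⟩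

lemma label_eq {x x' : ZMod 37 × (R × R) × (R × R)} {i j i' j' : Fin 9} (h : BaseAdj i j)
    (h' : BaseAdj i' j')
    (e : (vtx x j).1 - (vtx x i).1 = (vtx x' j').1 - (vtx x' i').1) : i = i' ∧ j = j' := by
  refine lab_sub_inj i j i' j' h h' ?_
  simpa [vtx] using e

lemma copy_eq (h30 : IsUnit (30 : R)) {x x' : ZMod 37 × (R × R) × (R × R)} {i j i' j' : Fin 9}
    (h : BaseAdj i j) (h' : BaseAdj i' j') (hi : vtx x i = vtx x' i') (hj : vtx x j = vtx x' j') :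
    x = x' := by
  obtain ⟨rfl, rfl⟩ := label_eq h h' (by rw [hi, hj])
  simp only [vtx, Prod.mk.injEq] at hi hj
  refine Prod.ext (add_right_cancel hi.1) (Prod.ext ?_ ?_)
  · exact form_inj h30 (baseColour_ne 0 i j h) hi.2.1 hj.2.1
  · exact form_inj h30 (baseColour_ne 1 i j h) hi.2.2 hj.2.2

lemma exists_adj_of_mem {e : Finset (ZMod 37 × R × R)} {x : ZMod 37 × (R × R) × (R × R)}
    {f : Finset (Fin 9)} (hf : f ∈ baseTriples) (h : f.map (copyEmb x) = e) {u v : ZMod 37 × R × R}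
    (hu : u ∈ e) (hv : v ∈ e) (huv : u ≠ v) :
    ∃ i ∈ f, ∃ j ∈ f, BaseAdj i j ∧ vtx x i = u ∧ vtx x j = v := by
  subst h
  obtain ⟨i, hi, rfl⟩ := Finset.mem_map.1 hu
  obtain ⟨j, hj, rfl⟩ := Finset.mem_map.1 hv
  exact ⟨i, hi, j, hj, ⟨fun h => huv (by rw [h]), f, hf, hi, hj⟩, rfl, rfl⟩

variable [DecidableEq R]

lemma copy_eq_of_card_inter (h30 : IsUnit (30 : R)) {x x' : ZMod 37 × (R × R) × (R × R)}
    {f f' : Finset (Fin 9)} (hf : f ∈ baseTriples) (hf' : f' ∈ baseTriples)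
    (h : 2 ≤ (f.map (copyEmb x) ∩ f'.map (copyEmb x')).card) : x = x' := by
  obtain ⟨u, hu, v, hv, huv⟩ := exists_two_of_two_le_card h
  rw [mem_inter] at hu hv
  obtain ⟨i, -, j, -, hij, hi, hj⟩ := exists_adj_of_mem hf rfl hu.1 hv.1 huv
  obtain ⟨i', -, j', -, hij', hi', hj'⟩ := exists_adj_of_mem hf' rfl hu.2 hv.2 huv
  exact copy_eq h30 hij hij' (hi.trans hi'.symm) (hj.trans hj'.symm)

variable [Fintype R]

variable (R) in
/-- Parameters at which the four linear forms take distinct values. -/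
def genericPairs : Finset (R × R) := univ.filter fun p => ∀ c c', c ≠ c' → form c p ≠ form c' p

lemma card_genericPairs (h30 : IsUnit (30 : R)) :
    Fintype.card R ^ 2 ≤ (genericPairs R).card + 12 * Fintype.card R := by
  have hcov : (univ : Finset (R × R)) ⊆ genericPairs R ∪ (univ : Finset (Fin 4)).offDiag.biUnion
      fun c => univ.filter fun p => form c.1 p = form c.2 p := by
    intro p _
    by_cases hp : p ∈ genericPairs R
    · exact mem_union_left _ hp
    · simp only [genericPairs, Finset.mem_filter, Finset.mem_univ, true_and] at hp
      push Not at hp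
      obtain ⟨c, c', hc, h⟩ := hp
      apply mem_union_right
      rw [mem_biUnion]
      exact ⟨(c, c'), by simpa using hc, by simpa using h⟩
  have hb : ((univ : Finset (Fin 4)).offDiag.biUnion
      fun c => univ.filter fun p : R × R => form c.1 p = form c.2 p).card ≤
      (univ : Finset (Fin 4)).offDiag.card * Fintype.card R := by
    apply card_biUnion_le_card_mul
    rintro ⟨c, c'⟩ hc
    have hc : c ≠ c' := by simpa using hc
    rw [← card_univ (α := R)]
    apply card_le_card_of_injOn (fun p => p.1 + p.2) (by simp)
    rintro ⟨a, b⟩ h ⟨a', b'⟩ h' hs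
    have h : form c (a, b) = form c' (a, b) := by simpa using h
    have h' : form c (a', b') = form c' (a', b') := by simpa using h'
    simp only [form] at h h' hs
    have hu := isUnit_intCast_of_dvd (R := R) (n := 1) h30 (by simpa using formDiff_dvd c c' hc)
    push_cast at hu
    have ha : a = a' := by
      apply hu.mul_left_cancel
      linear_combination h - h' - ((formCoeff c).2 - (formCoeff c').2 : R) * hs
    subst ha
    simpa using hs
  have h := (card_le_card hcov).trans (card_union_le _ _)
  rw [card_univ, Fintype.card_prod] at h
  have h12 : (univ : Finset (Fin 4)).offDiag.card = 12 := by decide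
  rw [h12] at hb
  nlinarith

variable (R) in
/-- Parameters of the copies used in the transversal hypergraph. -/
def copies : Finset (ZMod 37 × (R × R) × (R × R)) :=
  univ ×ˢ genericPairs R ×ˢ genericPairs R

lemma colour_eq_of_mem_copies {x : ZMod 37 × (R × R) × (R × R)} (hx : x ∈ copies R)
    {c c' : Fin 4} :
    (form c x.2.1 = form c' x.2.1 → c = c') ∧ (form c x.2.2 = form c' x.2.2 → c = c') := by
  simp only [copies, genericPairs, mem_product, Finset.mem_univ, Finset.mem_filter, true_and] at hx
  exact ⟨fun h => by_contra fun n => hx.1 _ _ n h, fun h => by_contra fun n => hx.2 _ _ n h⟩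

variable (R) in
/-- The transversal hypergraph: all copies of the base triples. -/
def transversal : Finset (Finset (ZMod 37 × R × R)) :=
  (copies R ×ˢ baseTriples).image fun y => y.2.map (copyEmb y.1)

lemma mem_transversal {e : Finset (ZMod 37 × R × R)} :
    e ∈ transversal R ↔ ∃ x ∈ copies R, ∃ f ∈ baseTriples, f.map (copyEmb x) = e := by
  simp only [transversal, Finset.mem_image, mem_product, Prod.exists, and_assoc, exists_and_left]

lemma card_transversal (h30 : IsUnit (30 : R)) :
    (transversal R).card = 259 * (genericPairs R).card ^ 2 := by
  rw [transversal, card_image_of_injOn, card_product, copies, card_product, card_product,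
    card_univ, ZMod.card, show baseTriples.card = 7 by decide]
  · ring
  · rintro ⟨x, f⟩ hf ⟨x', f'⟩ hf' h
    simp only [coe_product, Set.mem_prod, mem_coe] at hf hf' h
    obtain rfl : x = x' := by
      apply copy_eq_of_card_inter h30 hf.2 hf'.2
      rw [h, inter_self, card_map, baseTriples_card _ hf'.2]; omega
    rw [Finset.map_inj.1 h]

end Transversal

section TransversalGood

variable {R : Type*} [CommRing R]

/-- The algebra behind the Pasch condition: two diamonds over the same base pair. -/
lemma eq_of_form_relations {u v w w' a b c d e f : R} (h₁ : w * a + v * b + u * c = 0)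
    (h₄ : w * f + v * e + u * c = 0) {v' u' : R} (h₂ : w' * a + v' * e + u' * d = 0)
    (h₃ : w' * f + v' * b + u' * d = 0) (hu : IsUnit (w * v' + v * w')) : a = f := by
  apply hu.mul_left_cancel
  linear_combination v' * h₁ - v' * h₄ + v * h₂ - v * h₃

variable [DecidableEq R] [Fintype R]

lemma exists_vtx_of_triple_mem {a b c : ZMod 37 × R × R} (h : {a, b, c} ∈ transversal R) :
    ∃ x ∈ copies R, ∃ i j l, {i, j, l} ∈ baseTriples ∧ a = vtx x i ∧ b = vtx x j ∧ c = vtx x l := by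
  obtain ⟨x, hx, f, hf, h⟩ := mem_transversal.1 h
  have pull : ∀ v ∈ ({a, b, c} : Finset (ZMod 37 × R × R)), ∃ i, copyEmb x i = v := by
    intro v hv
    rw [← h] at hv
    obtain ⟨i, -, hi⟩ := Finset.mem_map.1 hv
    exact ⟨i, hi⟩
  obtain ⟨i, rfl⟩ := pull a (by simp)
  obtain ⟨j, rfl⟩ := pull b (by simp)
  obtain ⟨l, rfl⟩ := pull c (by simp)
  refine ⟨x, hx, i, j, l, ?_, rfl, rfl, rfl⟩
  have : f = {i, j, l} := by
    apply map_injective (copyEmb x)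
    rw [h]
    simp [map_insert]
  rwa [← this]

lemma ne_of_triple_mem {i j l : Fin 9} (h : {i, j, l} ∈ baseTriples) :
    BaseAdj i j ∧ BaseAdj i l ∧ BaseAdj j l := by
  revert i j l; decide +kernel

lemma baseAdj_symm {i j : Fin 9} (h : BaseAdj i j) : BaseAdj j i := by
  revert i j; decide +kernel

lemma transversal_inj {e : Finset (ZMod 37 × R × R)} (he : e ∈ transversal R) :
    ∀ u ∈ e, ∀ v ∈ e, u.1 = v.1 → u = v := by
  obtain ⟨x, -, f, -, rfl⟩ := mem_transversal.1 he
  intro u hu v hv h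
  obtain ⟨i, -, rfl⟩ := Finset.mem_map.1 hu
  obtain ⟨j, -, rfl⟩ := Finset.mem_map.1 hv
  rw [vtx_fst_injective x h]

lemma transversal_diamond_inj (h30 : IsUnit (30 : R)) {e₁ e₂ : Finset (ZMod 37 × R × R)}
    (m₁ : e₁ ∈ transversal R) (m₂ : e₂ ∈ transversal R) (h : 2 ≤ (e₁ ∩ e₂).card) :
    ∀ u ∈ e₁ ∪ e₂, ∀ v ∈ e₁ ∪ e₂, u.1 = v.1 → u = v := by
  obtain ⟨x, -, f₁, b₁, rfl⟩ := mem_transversal.1 m₁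
  obtain ⟨y, -, f₂, b₂, rfl⟩ := mem_transversal.1 m₂
  obtain rfl := copy_eq_of_card_inter h30 b₁ b₂ h
  rw [← map_union]
  intro u hu v hv h
  obtain ⟨i, -, rfl⟩ := Finset.mem_map.1 hu
  obtain ⟨j, -, rfl⟩ := Finset.mem_map.1 hv
  rw [vtx_fst_injective x h]

lemma exists_fan (h30 : IsUnit (30 : R)) {e₁ e₂ e₃ : Finset (ZMod 37 × R × R)}
    (m₁ : e₁ ∈ transversal R) (m₂ : e₂ ∈ transversal R) (m₃ : e₃ ∈ transversal R) (h12 : e₁ ≠ e₂)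
    (i12 : 2 ≤ (e₁ ∩ e₂).card) (hs : symmDiff e₁ e₂ ⊆ e₃) :
    ∃ x ∈ copies R, ∃ f₁ ∈ baseTriples, ∃ f₂ ∈ baseTriples, ∃ f₃ ∈ baseTriples,
      f₁.map (copyEmb x) = e₁ ∧ f₂.map (copyEmb x) = e₂ ∧ f₃.map (copyEmb x) = e₃ := by
  obtain ⟨x, hx, f₁, b₁, rfl⟩ := mem_transversal.1 m₁
  obtain ⟨y, -, f₂, b₂, rfl⟩ := mem_transversal.1 m₂
  obtain rfl := copy_eq_of_card_inter h30 b₁ b₂ i12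
  obtain ⟨z, -, f₃, b₃, rfl⟩ := mem_transversal.1 m₃
  rw [← map_inter, card_map] at i12
  rw [← finset_map_symmDiff] at hs
  obtain ⟨d2, -, -⟩ := card_symmDiff_diamond (baseTriples_card _ b₁) (baseTriples_card _ b₂)
    (fun h => h12 (by rw [h])) i12
  obtain ⟨i, hi, j, hj, hij⟩ := exists_two_of_two_le_card d2.ge
  have hadj := baseAdj_of_mem_symmDiff f₁ b₁ f₂ b₂ (fun h => h12 (by rw [h])) i12 i hi j hj hij
  obtain ⟨i', -, j', -, hadj', hi', hj'⟩ := exists_adj_of_mem b₃ rfl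
    (hs (Finset.mem_map_of_mem _ hi)) (hs (Finset.mem_map_of_mem _ hj))
    fun h => hij ((copyEmb x).injective h)
  obtain rfl : x = z := copy_eq h30 hadj hadj' hi'.symm hj'.symm
  exact ⟨x, hx, f₁, b₁, f₂, b₂, f₃, b₃, rfl, rfl, rfl⟩

lemma transversal_fan_inj (h30 : IsUnit (30 : R)) {e₁ e₂ e₃ : Finset (ZMod 37 × R × R)}
    (m₁ : e₁ ∈ transversal R) (m₂ : e₂ ∈ transversal R) (m₃ : e₃ ∈ transversal R) (h12 : e₁ ≠ e₂)
    (i12 : 2 ≤ (e₁ ∩ e₂).card) (hs : symmDiff e₁ e₂ ⊆ e₃) :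
    ∀ u ∈ e₁ ∪ e₂ ∪ e₃, ∀ v ∈ e₁ ∪ e₂ ∪ e₃, u.1 = v.1 → u = v := by
  obtain ⟨x, -, f₁, -, f₂, -, f₃, -, rfl, rfl, rfl⟩ := exists_fan h30 m₁ m₂ m₃ h12 i12 hs
  rw [← map_union, ← map_union]
  intro u hu v hv h
  obtain ⟨i, -, rfl⟩ := Finset.mem_map.1 hu
  obtain ⟨j, -, rfl⟩ := Finset.mem_map.1 hv
  rw [vtx_fst_injective x h]

lemma transversal_no_cone {a b c d e f : ZMod 37 × R × R} (hab : a.1 = b.1) (hbc : b.1 = c.1)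
    (m₁ : {a, d, e} ∈ transversal R) (m₂ : {b, d, f} ∈ transversal R)
    (m₃ : {c, e, f} ∈ transversal R) : False := by
  obtain ⟨x, -, i₁, j₁, l₁, t₁, rfl, rfl, rfl⟩ := exists_vtx_of_triple_mem m₁
  obtain ⟨y, -, i₂, j₂, l₂, t₂, rfl, hd, rfl⟩ := exists_vtx_of_triple_mem m₂
  obtain ⟨z, -, i₃, j₃, l₃, t₃, rfl, he, hf⟩ := exists_vtx_of_triple_mem m₃
  obtain ⟨a₁, b₁, -⟩ := ne_of_triple_mem t₁
  obtain ⟨a₂, b₂, -⟩ := ne_of_triple_mem t₂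
  obtain ⟨a₃, b₃, -⟩ := ne_of_triple_mem t₃
  obtain ⟨rfl, rfl⟩ := label_eq a₁ a₂ (by rw [hd, hab])
  obtain ⟨rfl, rfl⟩ := label_eq b₁ a₃ (by rw [he, hab, hbc])
  obtain ⟨-, rfl⟩ := label_eq (x := y) (x' := z) b₂ b₃ (by rw [hf, hbc])
  exact baseTriples_no_three_on_four _ _ _ _ t₁ t₂ t₃

lemma transversal_pasch_aux (h30 : IsUnit (30 : R)) {a b c d e f : ZMod 37 × R × R}
    (m₁ : {a, b, c} ∈ transversal R) (m₂ : {a, d, e} ∈ transversal R)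
    (m₃ : {b, d, f} ∈ transversal R) (m₄ : {c, e, f} ∈ transversal R) (haf : a.1 = f.1)
    (hbe : b.1 = e.1) : a = f := by
  obtain ⟨x₁, -, i, j, l, t₁, ha, hb, hc⟩ := exists_vtx_of_triple_mem m₁
  obtain ⟨x₂, -, i₂, l', j₂, t₂, ha₂, hd, he⟩ := exists_vtx_of_triple_mem m₂
  obtain ⟨x₃, -, j₃, l₃, i₃, t₃, hb₃, hd₃, hf⟩ := exists_vtx_of_triple_mem m₃
  obtain ⟨x₄, -, l₄, j₄, i₄, t₄, hc₄, he₄, hf₄⟩ := exists_vtx_of_triple_mem m₄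
  obtain ⟨ij, il, -⟩ := ne_of_triple_mem t₁
  obtain ⟨il₂, ij₂, -⟩ := ne_of_triple_mem t₂
  obtain ⟨jl₃, ji₃, li₃⟩ := ne_of_triple_mem t₃
  obtain ⟨lj₄, li₄, ji₄⟩ := ne_of_triple_mem t₄
  obtain ⟨rfl, rfl⟩ := label_eq ij ij₂ (by rw [← ha, ← ha₂, ← hb, ← he, hbe])
  obtain ⟨rfl, rfl⟩ := label_eq ij (baseAdj_symm ji₃) (by rw [← ha, ← hf, ← hb, ← hb₃, haf])
  obtain ⟨rfl, rfl⟩ := label_eq ij (baseAdj_symm ji₄) (by rw [← ha, ← hf₄, ← hb, ← he₄, haf, hbe])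
  obtain ⟨-, rfl⟩ := label_eq (x := x₂) (x' := x₃) il₂ (baseAdj_symm li₃)
    (by rw [← ha₂, ← hf, ← hd, ← hd₃, haf])
  obtain ⟨-, rfl⟩ := label_eq (x := x₁) (x' := x₄) il (baseAdj_symm li₄)
    (by rw [← ha, ← hf₄, ← hc, ← hc₄, haf])
  have hdet : ∀ t : Fin 2, IsUnit
      ((formDet (baseColour t j) (baseColour t l) : R) *
        formDet (baseColour t l') (baseColour t i) +
      formDet (baseColour t l) (baseColour t i) * formDet (baseColour t j) (baseColour t l')) := by
    intro t
    have hj : ({i, j, l'} : Finset (Fin 9)) ∈ baseTriples := by rwa [pair_comm] at t₂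
    simpa using isUnit_intCast_of_dvd h30 (formDet_pasch_dvd t i j l l' t₁ hj)
  simp only [vtx, Prod.ext_iff] at ha hb hc ha₂ hd he hb₃ hd₃ hf hc₄ he₄ hf₄
  have plu := fun (t : Fin 2) (l : Fin 9) (p : R × R) =>
    formDet_plucker (baseColour t i) (baseColour t j) (baseColour t l) p
  refine Prod.ext haf (Prod.ext ?_ ?_)
  · have g₁ := plu 0 l x₁.2.1
    have g₂ := plu 0 l' x₂.2.1
    have g₃ := plu 0 l' x₃.2.1
    have g₄ := plu 0 l x₄.2.1
    rw [← ha.2.1, ← hb.2.1, ← hc.2.1] at g₁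
    rw [← ha₂.2.1, ← hd.2.1, ← he.2.1] at g₂
    rw [← hb₃.2.1, ← hd₃.2.1, ← hf.2.1] at g₃
    rw [← hc₄.2.1, ← he₄.2.1, ← hf₄.2.1] at g₄
    exact eq_of_form_relations g₁ g₄ g₂ g₃ (hdet 0)
  · have g₁ := plu 1 l x₁.2.2
    have g₂ := plu 1 l' x₂.2.2
    have g₃ := plu 1 l' x₃.2.2
    have g₄ := plu 1 l x₄.2.2
    rw [← ha.2.2, ← hb.2.2, ← hc.2.2] at g₁
    rw [← ha₂.2.2, ← hd.2.2, ← he.2.2] at g₂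
    rw [← hb₃.2.2, ← hd₃.2.2, ← hf.2.2] at g₃
    rw [← hc₄.2.2, ← he₄.2.2, ← hf₄.2.2] at g₄
    exact eq_of_form_relations g₁ g₄ g₂ g₃ (hdet 1)

lemma exists_diffPairs {a b c : ZMod 37 × R × R} (h : {a, b, c} ∈ transversal R) :
    ∃ s ∈ diffPairs, b.1 - a.1 = (s.1 : ℕ) ∧ c.1 - a.1 = (s.2 : ℕ) := by
  obtain ⟨x, -, i, j, l, t, rfl, rfl, rfl⟩ := exists_vtx_of_triple_mem h
  simpa [vtx] using mem_diffPairs i j l t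

lemma transversal_pasch_labels {a b c d e f : ZMod 37 × R × R}
    (m₁ : {a, b, c} ∈ transversal R) (m₂ : {a, d, e} ∈ transversal R)
    (m₃ : {b, d, f} ∈ transversal R) (m₄ : {c, e, f} ∈ transversal R) :
    a.1 = f.1 ∧ b.1 = e.1 ∨ a.1 = f.1 ∧ c.1 = d.1 ∨ b.1 = e.1 ∧ c.1 = d.1 := by
  obtain ⟨s, hs, s₁, s₂⟩ := exists_diffPairs m₁
  obtain ⟨t, ht, t₁, t₂⟩ := exists_diffPairs m₂
  obtain ⟨u, hu, u₁, u₂⟩ := exists_diffPairs m₃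
  obtain ⟨v, hv, v₁, v₂⟩ := exists_diffPairs m₄
  have h := diffPairs_pasch s hs t ht u hu v hv (by rw [← s₁, ← t₁, ← u₁]; ring)
    (by rw [← s₂, ← t₂, ← v₁]; ring) (by rw [← s₁, ← s₂, ← u₂, ← v₂]; ring)
  rw [← s₁, ← s₂, ← t₁, ← t₂, ← u₂] at h
  have p : b.1 - a.1 + (f.1 - b.1) = 0 → a.1 = f.1 := fun h => by linear_combination -h
  have q : ∀ x y : ZMod 37, x - a.1 = y - a.1 → x = y := fun x y h => by linear_combination h
  rcases h with ⟨h, h'⟩ | ⟨h, h'⟩ | ⟨h, h'⟩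
  · exact Or.inl ⟨p h, q _ _ h'⟩
  · exact Or.inr (Or.inl ⟨p h, q _ _ h'⟩)
  · exact Or.inr (Or.inr ⟨q _ _ h, q _ _ h'⟩)

lemma transversal_pasch (h30 : IsUnit (30 : R)) {a b c d e f : ZMod 37 × R × R}
    (m₁ : {a, b, c} ∈ transversal R) (m₂ : {a, d, e} ∈ transversal R)
    (m₃ : {b, d, f} ∈ transversal R) (m₄ : {c, e, f} ∈ transversal R) :
    a = f ∨ b = e ∨ c = d := by
  rcases transversal_pasch_labels m₁ m₂ m₃ m₄ with ⟨h, h'⟩ | ⟨h, h'⟩ | ⟨h, h'⟩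
  · exact Or.inl (transversal_pasch_aux h30 m₁ m₂ m₃ m₄ h h')
  · refine Or.inl (transversal_pasch_aux h30 (b := c) (c := b) (d := e) (e := d) ?_ ?_ m₄ m₃ h h')
    · rwa [pair_comm]
    · rwa [pair_comm]
  · refine Or.inr (Or.inl (transversal_pasch_aux h30 (a := b) (b := c) (c := a) (d := f) (e := d)
      (f := e) ?_ ?_ ?_ m₂ h h'))
    · rwa [pair_comm, insert_comm]
    · rwa [pair_comm]
    · rwa [pair_comm]

lemma transversal_good (h30 : IsUnit (30 : R)) : Good (transversal R) where
  card_eq e m := by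
    obtain ⟨x, -, f, b, rfl⟩ := mem_transversal.1 m
    rw [card_map, baseTriples_card f b]
  not_chain e₁ m₁ e₂ m₂ e₃ m₃ h12 h23 h13 i12 i23 := by
    obtain ⟨x, -, f₁, b₁, rfl⟩ := mem_transversal.1 m₁
    obtain ⟨y, -, f₂, b₂, rfl⟩ := mem_transversal.1 m₂
    obtain ⟨z, -, f₃, b₃, rfl⟩ := mem_transversal.1 m₃
    obtain rfl := copy_eq_of_card_inter h30 b₁ b₂ i12
    obtain rfl := copy_eq_of_card_inter h30 b₂ b₃ i23
    simp only [ne_eq, Finset.map_inj, ← map_inter, card_map] at h12 h23 h13 i12 i23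
    exact baseTriples_not_chain _ b₁ _ b₂ _ b₃ h12 h23 h13 i12 i23
  not_twin e₁ m₁ e₂ m₂ e₃ m₃ e₄ m₄ h12 h34 h13 h14 i12 i34 hs := by
    obtain ⟨x, -, f₁, b₁, rfl⟩ := mem_transversal.1 m₁
    obtain ⟨y, -, f₂, b₂, rfl⟩ := mem_transversal.1 m₂
    obtain rfl := copy_eq_of_card_inter h30 b₁ b₂ i12
    obtain ⟨z, -, f₃, b₃, rfl⟩ := mem_transversal.1 m₃
    obtain ⟨w, -, f₄, b₄, rfl⟩ := mem_transversal.1 m₄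
    obtain rfl := copy_eq_of_card_inter h30 b₃ b₄ i34
    rw [← finset_map_symmDiff, ← finset_map_symmDiff] at hs
    simp only [ne_eq, Finset.map_inj, ← map_inter, card_map] at h12 h34 i12 i34
    obtain ⟨d2, -, -⟩ := card_symmDiff_diamond (baseTriples_card _ b₁) (baseTriples_card _ b₂)
      h12 i12
    obtain ⟨i, hi, j, hj, hij⟩ := exists_two_of_two_le_card d2.ge
    have ai := Finset.mem_map_of_mem (copyEmb x) hi
    have aj := Finset.mem_map_of_mem (copyEmb x) hj
    rw [hs] at ai aj
    obtain ⟨i', hi', ei⟩ := Finset.mem_map.1 ai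
    obtain ⟨j', hj', ej⟩ := Finset.mem_map.1 aj
    have hij' : i' ≠ j' := by
      rintro rfl
      exact hij ((copyEmb x).injective (ei.symm.trans ej))
    obtain rfl : x = z := copy_eq h30
      (baseAdj_of_mem_symmDiff f₁ b₁ f₂ b₂ h12 i12 i hi j hj hij)
      (baseAdj_of_mem_symmDiff f₃ b₃ f₄ b₄ h34 i34 i' hi' j' hj' hij') ei.symm ej.symm
    simp only [ne_eq, Finset.map_inj] at h13 h14 hs
    exact baseTriples_not_twin _ b₁ _ b₂ _ b₃ _ b₄ h12 h34 h13 h14 i12 i34 hs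
  not_fan e₁ m₁ e₂ m₂ e₃ m₃ e₄ m₄ h12 h13 h23 h14 h24 h34 i12 hs i4 := by
    obtain ⟨x, hx, f₁, b₁, f₂, b₂, f₃, b₃, rfl, rfl, rfl⟩ := exists_fan h30 m₁ m₂ m₃ h12 i12 hs
    obtain ⟨y, hy, f₄, b₄, rfl⟩ := mem_transversal.1 m₄
    obtain ⟨u, hu, v, hv, huv⟩ := exists_two_of_two_le_card i4
    rw [← map_union, ← map_union, mem_inter] at hu hv
    obtain ⟨i, hi, rfl⟩ := Finset.mem_map.1 hu.2
    obtain ⟨j, hj, rfl⟩ := Finset.mem_map.1 hv.2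
    obtain ⟨i', -, j', -, hadj', hi', hj'⟩ := exists_adj_of_mem b₄ rfl hu.1 hv.1 huv
    simp only [ne_eq, Finset.map_inj, ← map_inter, card_map, ← finset_map_symmDiff,
      map_subset_map] at h12 h13 h23 i12 hs
    have hij : i ≠ j := fun h => huv (by rw [h])
    rcases baseAdj_or_of_fan _ b₁ _ b₂ _ b₃ h12 h13 h23 i12 hs i hi j hj hij with hadj | ⟨t, ht⟩
    · obtain rfl : x = y := copy_eq h30 hadj hadj' hi'.symm hj'.symm
      simp only [ne_eq, Finset.map_inj, ← map_inter, ← map_union, card_map] at h14 h24 h34 i4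
      exact baseTriples_not_fan _ b₁ _ b₂ _ b₃ _ b₄ h12 h13 h23 h14 h24 h34 i12 hs i4
    · have hi' : vtx y i' = vtx x i := hi'
      have hj' : vtx y j' = vtx x j := hj'
      simp only [vtx, Prod.ext_iff] at hi' hj'
      refine baseColour_ne t i' j' hadj' ?_
      fin_cases t
      · refine (colour_eq_of_mem_copies hy).1 (hi'.2.1.trans (Eq.trans ?_ hj'.2.1.symm))
        exact congrArg (fun c => form c x.2.1) ht
      · refine (colour_eq_of_mem_copies hy).2 (hi'.2.2.trans (Eq.trans ?_ hj'.2.2.symm))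
        exact congrArg (fun c => form c x.2.2) ht
  not_pasch a b c d e f := transversal_pasch h30

lemma good_transversal_union (h30 : IsUnit (30 : R))
    {L : ZMod 37 → Finset (Finset (ZMod 37 × R × R))} (hL : ∀ k, Good (L k))
    (mono : ∀ k, ∀ e ∈ L k, ∀ v ∈ e, v.1 = k) :
    Good (transversal R ∪ univ.biUnion L) :=
  Good.glue Prod.fst (transversal_good h30) hL (fun _ he => transversal_inj he) mono
    (fun _ _ _ _ _ _ h h' m₁ m₂ m₃ _ _ _ => transversal_no_cone h h' m₁ m₂ m₃)
    (fun _ m₁ _ m₂ _ h => transversal_diamond_inj h30 m₁ m₂ h)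
    (fun _ m₁ _ m₂ _ m₃ h12 _ _ i12 hs => transversal_fan_inj h30 m₁ m₂ m₃ h12 i12 hs)

end TransversalGood

section Lower

/-- There is a good hypergraph with `N` edges on `n` vertices. -/
def HasGood (n N : ℕ) : Prop := ∃ G : Finset (Finset (Fin n)), Good G ∧ G.card = N

lemma Good.hasGood {V : Type*} [Fintype V] [DecidableEq V] {G : Finset (Finset V)} (hG : Good G) :
    HasGood (Fintype.card V) G.card :=
  ⟨_, hG.map (Fintype.equivFin V).toEmbedding, card_map _⟩

lemma HasGood.mono {n n' N : ℕ} (h : HasGood n N) (hn : n ≤ n') : HasGood n' N := by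
  obtain ⟨G, hG, rfl⟩ := h
  exact ⟨_, hG.map (Fin.castLEEmb hn), card_map _⟩

lemma HasGood.step {k N : ℕ} (h : HasGood ((30 * k + 1) ^ 2) N) :
    ∃ q : ℕ, (30 * k + 1) ^ 2 ≤ q + 12 * (30 * k + 1) ∧
      HasGood (37 * (30 * k + 1) ^ 2) (259 * q ^ 2 + 37 * N) := by
  obtain ⟨m, hm⟩ : ∃ m, m = 30 * k + 1 := ⟨_, rfl⟩
  rw [← hm] at h ⊢
  obtain ⟨G, hG, rfl⟩ := h
  have : NeZero m := ⟨by omega⟩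
  have h30 : IsUnit (30 : ZMod m) := by
    refine IsUnit.of_mul_eq_one (-(k : ZMod m)) ?_
    have h : ((30 * k + 1 : ℕ) : ZMod m) = 0 := by rw [← hm, ZMod.natCast_self]
    push_cast at h
    linear_combination -h
  have hcard : Fintype.card (ZMod m × ZMod m) = m ^ 2 := by
    rw [Fintype.card_prod, ZMod.card, sq]
  let φ : Fin (m ^ 2) ≃ ZMod m × ZMod m := (Fintype.equivFinOfCardEq hcard).symm
  let ψ : ZMod 37 → (Fin (m ^ 2) ↪ ZMod 37 × ZMod m × ZMod m) := fun x =>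
    ⟨fun i => (x, φ i), fun i j h => φ.injective (congrArg Prod.snd h)⟩
  let L : ZMod 37 → Finset (Finset (ZMod 37 × ZMod m × ZMod m)) :=
    fun x => G.map (mapEmbedding (ψ x)).toEmbedding
  have hL : ∀ x, Good (L x) := fun x => hG.map (ψ x)
  have mono : ∀ x, ∀ e ∈ L x, ∀ v ∈ e, v.1 = x := by
    intro x e he v hv
    simp only [L, Finset.mem_map, RelEmbedding.coe_toEmbedding, mapEmbedding_apply] at he
    obtain ⟨f, -, rfl⟩ := he
    obtain ⟨i, -, rfl⟩ := Finset.mem_map.1 hv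
    rfl
  refine ⟨(genericPairs (ZMod m)).card, ?_, ?_⟩
  · simpa [ZMod.card] using card_genericPairs h30
  have hgood := (good_transversal_union h30 hL mono).hasGood
  have hpair : ((univ : Finset (ZMod 37)) : Set (ZMod 37)).PairwiseDisjoint L := by
    intro x _ y _ hxy
    rw [Function.onFun, Finset.disjoint_left]
    intro e he he'
    obtain ⟨v, hv⟩ : e.Nonempty := card_pos.1 (by rw [(hL x).card_eq e he]; omega)
    exact hxy ((mono x e he v hv).symm.trans (mono y e he' v hv))
  have hdisj : Disjoint (transversal (ZMod m)) (univ.biUnion L) := by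
    rw [Finset.disjoint_left]
    intro e he he'
    obtain ⟨x, -, hx⟩ := mem_biUnion.1 he'
    obtain ⟨u, hu, v, hv, huv⟩ := exists_two_of_two_le_card (s := e)
      (by rw [(hL x).card_eq e hx]; omega)
    exact huv (transversal_inj he u hu v hv ((mono x e hx u hu).trans (mono x e hx v hv).symm))
  have hsum : ∑ x, (L x).card = 37 * G.card := by
    simp [L, ZMod.card]
  rw [card_union_of_disjoint hdisj, card_transversal h30, card_biUnion hpair, hsum] at hgood
  rwa [Fintype.card_prod, hcard, ZMod.card] at hgood

/-- Good hypergraphs of density at least `c` (relative to `n ^ 2`) exist asymptotically. -/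
def AsympGood (c : ℝ) : Prop :=
  ∀ ε > 0, ∃ n₁ : ℕ, ∀ n ≥ n₁, ∃ N : ℕ, HasGood n N ∧ (c - ε) * (n : ℝ) ^ 2 ≤ N

lemma asympGood_zero : AsympGood 0 := by
  intro ε hε
  refine ⟨0, fun n _ => ⟨0, ⟨∅, good_empty, rfl⟩, ?_⟩⟩
  have := mul_nonneg hε.le (sq_nonneg (n : ℝ))
  push_cast
  linarith

lemma exists_base_size (n : ℕ) (hn : 37 ≤ n) :
    ∃ k : ℕ, 37 * (30 * k + 1) ^ 2 ≤ n ∧ n < 37 * (30 * k + 31) ^ 2 := by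
  have hs : Nat.sqrt (n / 37) ^ 2 ≤ n / 37 := Nat.sqrt_le' _
  have hs' : n / 37 < (Nat.sqrt (n / 37) + 1) ^ 2 := Nat.lt_succ_sqrt' _
  set s := Nat.sqrt (n / 37)
  have hs1 : 1 ≤ s := by
    by_contra h
    have : s = 0 := by omega
    rw [this] at hs'
    omega
  refine ⟨(s - 1) / 30, ?_, ?_⟩
  · have h : 30 * ((s - 1) / 30) + 1 ≤ s := by omega
    have := Nat.pow_le_pow_left h 2
    omega
  · have h : s + 1 ≤ 30 * ((s - 1) / 30) + 31 := by omega
    have := Nat.pow_le_pow_left h 2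
    omega

lemma density_estimate {c ε m q N n : ℝ} (hc1 : c ≤ 1) (hm : 30 ≤ m)
    (hεm : 106 ≤ ε * m) (hq : m ^ 2 ≤ q + 12 * m) (hN : (c - ε) * (m ^ 2) ^ 2 ≤ N) (hn0 : 0 ≤ n)
    (hn : n ≤ 37 * (m + 30) ^ 2) (hN0 : 0 ≤ N) :
    ((7 + c) / 37 - ε) * n ^ 2 ≤ 259 * q ^ 2 + 37 * N := by
  by_cases hneg : (7 + c) / 37 - ε ≤ 0
  · nlinarith [mul_nonneg (sub_nonneg.2 hneg) (sq_nonneg n), sq_nonneg q]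
  push Not at hneg
  have hε : 0 < ε := by
    by_contra h
    push Not at h
    nlinarith
  have h1 : n ^ 2 ≤ (37 * (m + 30) ^ 2) ^ 2 := pow_le_pow_left₀ hn0 hn 2
  have h2 : (m ^ 2 - 12 * m) ^ 2 ≤ q ^ 2 := by
    apply pow_le_pow_left₀ _ (by linarith)
    nlinarith
  have h3 : (m + 30) ^ 4 ≤ m ^ 4 + 450 * m ^ 3 := by
    have e1 : 0 ≤ (m - 30) * m := by nlinarith
    have e2 : 0 ≤ (m - 30) * m ^ 2 := by nlinarith
    have e3 : 900 * m ≤ m ^ 3 := by nlinarith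
    have e4 : 27000 ≤ m ^ 3 := by nlinarith
    nlinarith
  have hm3 : 0 ≤ m ^ 3 := by positivity
  calc ((7 + c) / 37 - ε) * n ^ 2 ≤ ((7 + c) / 37 - ε) * (37 * (m + 30) ^ 2) ^ 2 :=
        mul_le_mul_of_nonneg_left h1 hneg.le
    _ = 1369 * ((7 + c) / 37 - ε) * (m + 30) ^ 4 := by ring
    _ ≤ 1369 * ((7 + c) / 37 - ε) * (m ^ 4 + 450 * m ^ 3) :=
        mul_le_mul_of_nonneg_left h3 (by linarith)
    _ ≤ 259 * (m ^ 2 - 12 * m) ^ 2 + 37 * ((c - ε) * (m ^ 2) ^ 2) := by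
        have f1 : 0 ≤ (ε * m - 106) * m ^ 3 := mul_nonneg (by linarith) hm3
        have f2 : 0 ≤ (1 - c) * m ^ 3 := mul_nonneg (by linarith) hm3
        have f3 : 0 ≤ ε * m ^ 3 := by positivity
        nlinarith [sq_nonneg m]
    _ ≤ 259 * q ^ 2 + 37 * N := by linarith

lemma AsympGood.step {c : ℝ} (hc1 : c ≤ 1) (h : AsympGood c) :
    AsympGood ((7 + c) / 37) := by
  intro ε hε
  obtain ⟨n₁, h₁⟩ := h ε hε
  obtain ⟨m₀, hm₀⟩ := exists_nat_gt (106 / ε)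
  refine ⟨37 * (n₁ + m₀ + 61) ^ 2, fun n hn => ?_⟩
  obtain ⟨k, hk, hk'⟩ := exists_base_size n (by
    have : 1 ≤ (n₁ + m₀ + 61) ^ 2 := Nat.one_le_pow _ _ (by omega)
    omega)
  have hm : n₁ + m₀ + 61 < 30 * k + 31 := by
    by_contra hc
    have := Nat.pow_le_pow_left (not_lt.1 hc) 2
    omega
  obtain ⟨N, hN, hNb⟩ := h₁ ((30 * k + 1) ^ 2) (by nlinarith)
  obtain ⟨q, hq, hg⟩ := hN.step
  refine ⟨_, hg.mono hk, ?_⟩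
  have hmr : (n₁ : ℝ) + m₀ + 30 ≤ 30 * k + 1 := by
    exact_mod_cast (by omega : n₁ + m₀ + 30 ≤ 30 * k + 1)
  have hn₁ : (0 : ℝ) ≤ n₁ := Nat.cast_nonneg _
  have hm₀' : (0 : ℝ) ≤ m₀ := Nat.cast_nonneg _
  push_cast at hNb ⊢
  refine density_estimate (m := 30 * k + 1) hc1 (by linarith) ?_ (by exact_mod_cast hq) hNb
    (Nat.cast_nonneg _) ?_ (Nat.cast_nonneg _)
  · rw [div_lt_iff₀ hε] at hm₀
    nlinarith
  · have : (n : ℝ) ≤ 37 * (30 * k + 31) ^ 2 := by exact_mod_cast hk'.le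
    linarith

lemma asympGood_sub (j : ℕ) : AsympGood (7 / 36 * (1 - (1 / 37) ^ j)) := by
  induction j with
  | zero => simpa using asympGood_zero
  | succ j ih =>
    have h1 : ((1 : ℝ) / 37) ^ j ≤ 1 := pow_le_one₀ (by norm_num) (by norm_num)
    have h0 : 0 ≤ ((1 : ℝ) / 37) ^ j := by positivity
    convert ih.step (by linarith) using 1
    rw [pow_succ]
    ring

lemma asympGood_main : AsympGood (7 / 36) := by
  intro ε hε
  obtain ⟨j, hj⟩ := exists_pow_lt_of_lt_one (half_pos hε) (show (1 : ℝ) / 37 < 1 by norm_num)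
  obtain ⟨n₁, h⟩ := asympGood_sub j (ε / 2) (half_pos hε)
  refine ⟨n₁, fun n hn => ?_⟩
  obtain ⟨N, hN, hb⟩ := h n hn
  refine ⟨N, hN, le_trans (mul_le_mul_of_nonneg_right ?_ (sq_nonneg _)) hb⟩
  have h0 : 0 ≤ ((1 : ℝ) / 37) ^ j := by positivity
  linarith

lemma bddAbove_exNum (r n s k : ℕ) : BddAbove {m : ℕ | ∃ G : Finset (Finset (Fin n)),
    (∀ e ∈ G, e.card = r) ∧ IsFree G s k ∧ G.card = m} := by
  refine ⟨Fintype.card (Finset (Fin n)), ?_⟩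
  rintro _ ⟨G, -, -, rfl⟩
  exact card_le_univ G

lemma HasGood.le_exNum {n N : ℕ} (h : HasGood n N) : N ≤ exNum 3 n 6 4 := by
  obtain ⟨G, hG, rfl⟩ := h
  exact le_csSup (bddAbove_exNum 3 n 6 4) ⟨G, hG.card_eq, hG.isFree, rfl⟩

lemma exNum_lower {ε : ℝ} (hε : 0 < ε) :
    ∀ᶠ n : ℕ in atTop, (7 / 36 - ε) * (n : ℝ) ^ 2 ≤ exNum 3 n 6 4 := by
  obtain ⟨n₁, h⟩ := asympGood_main ε hε
  filter_upwards [eventually_ge_atTop n₁] with n hn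
  obtain ⟨N, hN, hb⟩ := h n hn
  exact hb.trans (by exact_mod_cast hN.le_exNum)

end Lower

section Upper

variable {V : Type*} [DecidableEq V]

/-- Four distinct edges span at least seven vertices. -/
def FourSpread (G : Finset (Finset V)) : Prop :=
  ∀ e₁ ∈ G, ∀ e₂ ∈ G, ∀ e₃ ∈ G, ∀ e₄ ∈ G, e₁ ≠ e₂ → e₁ ≠ e₃ → e₁ ≠ e₄ → e₂ ≠ e₃ → e₂ ≠ e₄ →
    e₃ ≠ e₄ → ∀ s : Finset V, e₁ ⊆ s → e₂ ⊆ s → e₃ ⊆ s → e₄ ⊆ s → 7 ≤ s.card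

/-- Three distinct edges span at least five vertices. -/
def ThreeSpread (G : Finset (Finset V)) : Prop :=
  ∀ e₁ ∈ G, ∀ e₂ ∈ G, ∀ e₃ ∈ G, e₁ ≠ e₂ → e₁ ≠ e₃ → e₂ ≠ e₃ →
    ∀ s : Finset V, e₁ ⊆ s → e₂ ⊆ s → e₃ ⊆ s → 5 ≤ s.card

lemma IsFree.fourSpread {G : Finset (Finset V)} (h : IsFree G 6 4) : FourSpread G := by
  intro e₁ m₁ e₂ m₂ e₃ m₃ e₄ m₄ h12 h13 h14 h23 h24 h34 s s₁ s₂ s₃ s₄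
  by_contra hs
  refine h ⟨{e₁, e₂, e₃, e₄}, ?_, ?_, ?_⟩
  · intro e he
    simp only [mem_insert, mem_singleton] at he
    rcases he with rfl | rfl | rfl | rfl <;> assumption
  · rw [card_insert_of_notMem (by simp [h12, h13, h14]),
      card_insert_of_notMem (by simp [h23, h24]), card_pair h34]
  · have : ({e₁, e₂, e₃, e₄} : Finset (Finset V)).sup id ≤ s := by
      apply Finset.sup_le
      intro e he
      simp only [mem_insert, mem_singleton] at he
      rcases he with rfl | rfl | rfl | rfl <;> assumption
    have := card_le_card this
    omega

lemma FourSpread.mono {V : Type*} {G G' : Finset (Finset V)} (h : FourSpread G) (hs : G' ⊆ G) :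
    FourSpread G' :=
  fun e₁ m₁ e₂ m₂ e₃ m₃ e₄ m₄ => h e₁ (hs m₁) e₂ (hs m₂) e₃ (hs m₃) e₄ (hs m₄)

lemma exists_third {g : Finset V} {u v : V} (hg : g.card = 3) (huv : u ≠ v) (hu : u ∈ g)
    (hv : v ∈ g) : ∃ w, w ≠ u ∧ w ≠ v ∧ g = {u, v, w} := by
  have hs : ({u, v} : Finset V) ⊆ g := by
    intro t ht
    simp only [mem_insert, mem_singleton] at ht
    rcases ht with rfl | rfl <;> assumption
  have h1 : (g \ {u, v}).card = 1 := by
    rw [card_sdiff_of_subset hs, card_pair huv, hg]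
  obtain ⟨w, hw⟩ := card_eq_one.1 h1
  have hw' : w ∈ g \ {u, v} := by simp [hw]
  simp only [Finset.mem_sdiff, mem_insert, mem_singleton, not_or] at hw'
  refine ⟨w, hw'.2.1, hw'.2.2, ?_⟩
  rw [← union_sdiff_of_subset hs, hw]
  ext t
  simp only [mem_union, mem_insert, mem_singleton, or_assoc]

/-- The edges belonging to three edges on four vertices. -/
def denseEdges (G : Finset (Finset V)) : Finset (Finset V) :=
  G.filter fun e => ∃ e' ∈ G, ∃ e'' ∈ G, e ≠ e' ∧ e ≠ e'' ∧ e' ≠ e'' ∧ (e ∪ e' ∪ e'').card ≤ 4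

lemma threeSpread_sdiff (G : Finset (Finset V)) : ThreeSpread (G \ denseEdges G) := by
  intro e₁ m₁ e₂ m₂ e₃ m₃ h12 h13 h23 s s₁ s₂ s₃
  by_contra hs
  rw [Finset.mem_sdiff] at m₁ m₂ m₃
  refine m₁.2 (Finset.mem_filter.2 ⟨m₁.1, e₂, m₂.1, e₃, m₃.1, h12, h13, h23, ?_⟩)
  have := card_le_card (union_subset (union_subset s₁ s₂) s₃)
  omega

lemma card_denseEdges_le [Fintype V] {G : Finset (Finset V)} (hc : ∀ e ∈ G, e.card = 3)
    (hf : FourSpread G) : (denseEdges G).card ≤ Fintype.card V := by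
  have h := card_mul_le_card_mul (s := denseEdges G) (t := (univ : Finset V)) (m := 3) (n := 3)
    (fun e v => v ∈ e) ?_ ?_
  · rw [card_univ] at h; omega
  · intro e he
    have : bipartiteAbove (fun (e : Finset V) v => v ∈ e) univ e = e := by
      ext v; simp [bipartiteAbove]
    rw [this, hc e (Finset.mem_filter.1 he).1]
  · intro v _
    by_contra hlt
    push Not at hlt
    obtain ⟨e, he⟩ := card_pos.1
      (by omega : 0 < #(bipartiteBelow (fun e v => v ∈ e) (denseEdges G) v))
    rw [mem_bipartiteBelow] at he
    obtain ⟨he, hv⟩ := he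
    obtain ⟨m, e', m', e'', m'', h1, h2, h3, h4⟩ := Finset.mem_filter.1 he
    have hsub : bipartiteBelow (fun e v => v ∈ e) (denseEdges G) v ⊆ {e, e', e''} := by
      intro g hg
      rw [mem_bipartiteBelow] at hg
      have mg := (Finset.mem_filter.1 hg.1).1
      by_contra hn
      simp only [mem_insert, mem_singleton, not_or] at hn
      have h7 := hf e m e' m' e'' m'' g mg h1 h2 (Ne.symm hn.1) h3 (Ne.symm hn.2.1)
        (Ne.symm hn.2.2) (e ∪ e' ∪ e'' ∪ g.erase v)
        (fun t ht => by simp [ht]) (fun t ht => by simp [ht]) (fun t ht => by simp [ht]) (by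
          intro t ht
          by_cases htv : t = v
          · subst htv; simp [hv]
          · simp [ht, htv])
      have := card_union_le (e ∪ e' ∪ e'') (g.erase v)
      rw [card_erase_of_mem hg.2, hc g mg] at this
      omega
    have := (card_le_card hsub).trans card_le_three
    omega

/-- The number of edges containing `p`. -/
def codeg (G : Finset (Finset V)) (p : Finset V) : ℕ := (G.filter (p ⊆ ·)).card

/-- An edge is isolated if no other edge shares two vertices with it. -/
def Isolated (G : Finset (Finset V)) (e : Finset V) : Prop :=
  ∀ f ∈ G, f ≠ e → (e ∩ f).card < 2

instance (G : Finset (Finset V)) (e : Finset V) : Decidable (Isolated G e) := by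
  unfold Isolated; infer_instance

/-- The pair `p` is missing from a diamond containing `e`. -/
def Missing (G : Finset (Finset V)) (e p : Finset V) : Prop :=
  ∃ f ∈ G, f ≠ e ∧ 2 ≤ (e ∩ f).card ∧ symmDiff e f = p

instance (G : Finset (Finset V)) (e p : Finset V) : Decidable (Missing G e p) := by
  unfold Missing; infer_instance

/-- The charge an edge receives from a pair it covers. -/
def coverCharge (G : Finset (Finset V)) (e p : Finset V) : ℕ :=
  if p ⊆ e then
    if Isolated G e then 12 else if codeg G p = 1 then 14 else if codeg G p = 2 then 7 else 4
  else 0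

/-- The charge an edge receives from a missing pair of a diamond. -/
def missCharge (G : Finset (Finset V)) (e p : Finset V) : ℕ :=
  if Missing G e p then if codeg G p = 0 then 7 else 1 else 0

section Pair

variable {G : Finset (Finset V)}

lemma Missing.not_subset (hc : ∀ e ∈ G, e.card = 3) {e p : Finset V} (he : e ∈ G)
    (h : Missing G e p) : ¬ p ⊆ e := by
  obtain ⟨f, hf, hne, h2, rfl⟩ := h
  obtain ⟨a, b, x, y, rfl, rfl, ab, ax, bx, ay, hby, xy⟩ :=
    exists_diamond (hc e he) (hc f hf) hne.symm h2
  rw [symmDiff_diamond ax bx ay hby xy]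
  intro hs
  have : y ∈ ({a, b, x} : Finset V) := hs (by simp)
  simp only [mem_insert, mem_singleton] at this
  rcases this with h | h | h
  exacts [ay h.symm, hby h.symm, xy h.symm]

lemma card_missing_le (hc : ∀ e ∈ G, e.card = 3) (hf : FourSpread G) (p : Finset V) :
    (G.filter fun e => Missing G e p).card ≤ 2 := by
  rcases (G.filter fun e => Missing G e p).eq_empty_or_nonempty with h | ⟨e, he⟩
  · simp [h]
  obtain ⟨m, f, mf, hne, h2, hp⟩ := Finset.mem_filter.1 he
  refine (card_le_card (t := {e, f}) ?_).trans card_le_two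
  intro g hg
  obtain ⟨mg, k, mk, hne', h2', hp'⟩ := Finset.mem_filter.1 hg
  by_contra hn
  simp only [mem_insert, mem_singleton, not_or] at hn
  have hk : k = symmDiff g p := by rw [← hp', symmDiff_symmDiff_cancel_left]
  have hf' : f = symmDiff e p := by rw [← hp, symmDiff_symmDiff_cancel_left]
  have he' : e = symmDiff f p := by rw [hf', symmDiff_symmDiff_cancel_right]
  have hg' : g = symmDiff k p := by rw [hk, symmDiff_symmDiff_cancel_right]
  have h7 := hf e m f mf g mg k mk hne.symm (Ne.symm hn.1)
    (fun h => hn.2 (by rw [hg', ← h, hf'])) (Ne.symm hn.2)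
    (fun h => hn.1 (by rw [hg', ← h, ← he'])) hne'.symm (e ∪ f ∪ (g ∪ k))
    (fun t ht => by simp [ht]) (fun t ht => by simp [ht]) (fun t ht => by simp [ht])
    (fun t ht => by simp [ht])
  obtain ⟨c1, c2, -⟩ := card_symmDiff_diamond (hc e m) (hc f mf) hne.symm h2
  obtain ⟨c1', c2', -⟩ := card_symmDiff_diamond (hc g mg) (hc k mk) hne'.symm h2'
  have hi : p ⊆ (e ∪ f) ∩ (g ∪ k) :=
    subset_inter (hp ▸ symmDiff_subset _ _) (hp' ▸ symmDiff_subset _ _)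
  have hi := card_le_card hi
  have := card_union_add_card_inter (e ∪ f) (g ∪ k)
  rw [← hp] at hi
  omega

lemma missing_unique (hc : ∀ e ∈ G, e.card = 3) (hf : FourSpread G) (hk : ThreeSpread G)
    {e p : Finset V} (he : e ∈ G) (h : Missing G e p) {f : Finset V} (mf : f ∈ G) (hpf : p ⊆ f)
    {g : Finset V} (mg : g ∈ G) (hgf : g ≠ f) (h2 : 2 ≤ (f ∩ g).card) : False := by
  have hnot := h.not_subset hc he
  obtain ⟨k, mk, hne, h2', hp⟩ := h
  have hnot' : ¬ p ⊆ k := by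
    refine Missing.not_subset hc mk ⟨e, he, hne.symm, by rwa [inter_comm], ?_⟩
    rw [symmDiff_comm, hp]
  have fe : f ≠ e := fun h => hnot (h ▸ hpf)
  have fk : f ≠ k := fun h => hnot' (h ▸ hpf)
  obtain ⟨c1, c2, -⟩ := card_symmDiff_diamond (hc e he) (hc k mk) hne.symm h2'
  rw [hp] at c1
  have hsub : p ⊆ (e ∪ k) ∩ f := subset_inter (hp ▸ symmDiff_subset _ _) hpf
  have hsub := card_le_card hsub
  have hcu := card_union_add_card_inter (e ∪ k) f
  have hcf := hc f mf
  have hcg := hc g mg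
  have hgsub : 2 ≤ ((e ∪ k ∪ f) ∩ g).card :=
    h2.trans (card_le_card (inter_subset_inter_right subset_union_right))
  have hcu' := card_union_add_card_inter (e ∪ k ∪ f) g
  by_cases hge : g = e ∨ g = k
  · have h3 : 2 < ((e ∪ k) ∩ f).card := by
      by_contra hle
      have hpe : p = (e ∪ k) ∩ f :=
        eq_of_subset_of_card_le (subset_inter (hp ▸ symmDiff_subset _ _) hpf) (by omega)
      have hfg : f ∩ g ⊆ p ∩ g := by
        intro t ht
        rw [mem_inter] at ht
        rw [hpe]
        simp only [mem_inter, mem_union]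
        refine ⟨⟨?_, ht.1⟩, ht.2⟩
        rcases hge with rfl | rfl
        exacts [Or.inl ht.2, Or.inr ht.2]
      have hpg : p ⊆ g := by
        have h1 := card_le_card hfg
        have : p ∩ g = p := eq_of_subset_of_card_le inter_subset_left (by omega)
        rw [← this]; exact inter_subset_right
      rcases hge with rfl | rfl
      exacts [hnot hpg, hnot' hpg]
    have := hk e he k mk f mf hne.symm fe.symm fk.symm (e ∪ k ∪ f)
      (fun t ht => by simp [ht]) (fun t ht => by simp [ht]) (fun t ht => by simp [ht])
    omega
  · push Not at hge
    have := hf e he k mk f mf g mg hne.symm fe.symm hge.1.symm fk.symm hge.2.symm hgf.symm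
      (e ∪ k ∪ f ∪ g) (fun t ht => by simp [ht]) (fun t ht => by simp [ht])
      (fun t ht => by simp [ht]) (fun t ht => by simp [ht])
    omega

lemma codeg_le_three (hc : ∀ e ∈ G, e.card = 3) (hf : FourSpread G) {p : Finset V}
    (hp : p.card = 2) : codeg G p ≤ 3 := by
  by_contra h
  push Not at h
  obtain ⟨S, hS, h4⟩ := exists_subset_card_eq (Nat.succ_le_of_lt h)
  obtain ⟨u, v, huv, rfl⟩ := card_eq_two.1 hp
  obtain ⟨e₁, e₂, e₃, e₄, h12, h13, h14, h23, h24, h34, rfl⟩ := card_eq_four.1 h4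
  have ex : ∀ e ∈ ({e₁, e₂, e₃, e₄} : Finset (Finset V)), e ∈ G ∧ ∃ w, e = {u, v, w} := by
    intro e he
    obtain ⟨m, hs⟩ := Finset.mem_filter.1 (hS he)
    obtain ⟨w, -, -, hw⟩ := exists_third (hc e m) huv (hs (by simp)) (hs (by simp))
    exact ⟨m, w, hw⟩
  obtain ⟨m₁, w₁, rfl⟩ := ex e₁ (by simp)
  obtain ⟨m₂, w₂, rfl⟩ := ex e₂ (by simp)
  obtain ⟨m₃, w₃, rfl⟩ := ex e₃ (by simp)
  obtain ⟨m₄, w₄, rfl⟩ := ex e₄ (by simp)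
  have h7 := hf _ m₁ _ m₂ _ m₃ _ m₄ h12 h13 h14 h23 h24 h34 {u, v, w₁, w₂, w₃, w₄}
    (by intro t; simp only [mem_insert, mem_singleton]; rintro (h | h | h) <;> simp [h])
    (by intro t; simp only [mem_insert, mem_singleton]; rintro (h | h | h) <;> simp [h])
    (by intro t; simp only [mem_insert, mem_singleton]; rintro (h | h | h) <;> simp [h])
    (by intro t; simp only [mem_insert, mem_singleton]; rintro (h | h | h) <;> simp [h])
  have := card_le_six (a := u) (b := v) (c := w₁) (d := w₂) (e := w₃) (f := w₄)
  omega

lemma sum_charge_le (hc : ∀ e ∈ G, e.card = 3) (hf : FourSpread G) (hk : ThreeSpread G)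
    {p : Finset V} (hp : p.card = 2) :
    ∑ e ∈ G, (coverCharge G e p + missCharge G e p) ≤ 14 := by
  have hM := card_missing_le hc hf p
  rw [sum_add_distrib]
  have hmiss : ∑ e ∈ G, missCharge G e p =
      (G.filter fun e => Missing G e p).card * if codeg G p = 0 then 7 else 1 := by
    simp only [missCharge]
    rw [← sum_filter, sum_const, smul_eq_mul]
  have hcover : ∑ e ∈ G, coverCharge G e p = ∑ e ∈ G.filter (p ⊆ ·),
      if Isolated G e then 12 else
        if codeg G p = 1 then 14 else if codeg G p = 2 then 7 else 4 := by
    simp only [coverCharge]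
    rw [← sum_filter]
  rw [hmiss, hcover]
  have hshare : ∀ e, p ⊆ e → ∀ e', p ⊆ e' → 2 ≤ (e ∩ e').card := fun e h e' h' =>
    hp ▸ card_le_card (subset_inter h h')
  obtain h0 | h0 := Nat.eq_zero_or_pos (codeg G p)
  · rw [if_pos h0, card_eq_zero.1 h0, sum_empty]
    omega
  rw [if_neg h0.ne']
  obtain h1 | h1 : codeg G p = 1 ∨ 2 ≤ codeg G p := by omega
  · obtain ⟨e, he⟩ := card_eq_one.1 h1
    have hee : e ∈ G.filter (p ⊆ ·) := by rw [he]; simp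
    rw [Finset.mem_filter] at hee
    rw [he, sum_singleton]
    by_cases hi : Isolated G e
    · rw [if_pos hi]; omega
    · rw [if_neg hi, if_pos h1]
      have : (G.filter fun e => Missing G e p) = ∅ := by
        rw [filter_eq_empty_iff]
        intro g mg hm
        simp only [Isolated, not_forall, not_lt] at hi
        obtain ⟨k, mk, hke, h2⟩ := hi
        exact missing_unique hc hf hk mg hm hee.1 hee.2 mk hke h2
      rw [this]; simp
  · have hex : ∀ e ∈ G.filter (p ⊆ ·), ∃ f ∈ G.filter (p ⊆ ·), f ≠ e := by
      intro e he
      obtain ⟨f, hf, hfe⟩ := exists_mem_ne (show 1 < (G.filter (p ⊆ ·)).card from h1) e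
      exact ⟨f, hf, hfe⟩
    have hiso : ∀ e ∈ G.filter (p ⊆ ·), ¬ Isolated G e := by
      intro e he hi
      obtain ⟨f, hf, hfe⟩ := hex e he
      rw [Finset.mem_filter] at he hf
      have := hi f hf.1 hfe
      have := hshare e he.2 f hf.2
      omega
    have hempty : (G.filter fun e => Missing G e p) = ∅ := by
      rw [filter_eq_empty_iff]
      intro g mg hm
      obtain ⟨e, he⟩ := card_pos.1 h0
      obtain ⟨f, hf', hfe⟩ := hex e he
      rw [Finset.mem_filter] at he hf'
      exact missing_unique hc hf hk mg hm he.1 he.2 hf'.1 hfe (hshare e he.2 f hf'.2)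
    rw [hempty, card_empty, zero_mul, add_zero,
      sum_congr rfl (fun e he => if_neg (hiso e he)), sum_const, smul_eq_mul]
    have h3 := codeg_le_three hc hf hp
    change codeg G p * _ ≤ 14
    generalize codeg G p = d at h1 h3
    interval_cases d <;> simp

end Pair

end Upper

section EdgeCharge

variable {V : Type*} [DecidableEq V] {G : Finset (Finset V)}

lemma mem_of_three_on_five (hc : ∀ e ∈ G, e.card = 3) (hf : FourSpread G) {e f h : Finset V}
    (me : e ∈ G) (mf : f ∈ G) (mh : h ∈ G) (hef : e ≠ f) (heh : e ≠ h) (hfh : f ≠ h)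
    {s : Finset V} (hs : s.card ≤ 5) (se : e ⊆ s) (sf : f ⊆ s) (sh : h ⊆ s) {g : Finset V}
    (mg : g ∈ G) {u v : V} (huv : u ≠ v) (hu : u ∈ s) (hv : v ∈ s) (hp : {u, v} ⊆ g) :
    g = e ∨ g = f ∨ g = h := by
  by_contra hn
  push Not at hn
  obtain ⟨w, -, -, rfl⟩ := exists_third (hc g mg) huv (hp (by simp)) (hp (by simp))
  have h7 := hf e me f mf h mh _ mg hef heh hn.1.symm hfh hn.2.1.symm hn.2.2.symm (insert w s)
    (se.trans (subset_insert _ _)) (sf.trans (subset_insert _ _)) (sh.trans (subset_insert _ _))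
    (by intro t; simp only [mem_insert, mem_singleton]; rintro (rfl | rfl | rfl) <;> simp [hu, hv])
  have := card_insert_le w s
  omega

lemma codeg_eq_one {e p : Finset V} (he : e ∈ G) (hp : p ⊆ e) (h : ∀ g ∈ G, p ⊆ g → g = e) :
    codeg G p = 1 := by
  refine card_eq_one.2 ⟨e, ?_⟩
  ext g
  simp only [Finset.mem_filter, mem_singleton]
  exact ⟨fun hg => h g hg.1 hg.2, fun hg => hg ▸ ⟨he, hp⟩⟩

lemma codeg_eq_two {e f p : Finset V} (he : e ∈ G) (hp : p ⊆ e) (hf : f ∈ G) (hp' : p ⊆ f)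
    (hne : e ≠ f) (h : ∀ g ∈ G, p ⊆ g → g = e ∨ g = f) : codeg G p = 2 := by
  refine card_eq_two.2 ⟨e, f, hne, ?_⟩
  ext g
  simp only [Finset.mem_filter, mem_insert, mem_singleton]
  refine ⟨fun hg => h g hg.1 hg.2, ?_⟩
  rintro (rfl | rfl)
  exacts [⟨he, hp⟩, ⟨hf, hp'⟩]

lemma diamond_inter {a b x y : V} (ab : a ≠ b) :
    2 ≤ (({a, b, x} : Finset V) ∩ {a, b, y}).card := by
  rw [← card_pair ab]
  exact card_le_card (subset_inter (by intro; simp; tauto) (by intro; simp; tauto))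

lemma triple_ne {a b x y : V} (ay : a ≠ y) (hby : b ≠ y) (xy : x ≠ y) :
    ({a, b, x} : Finset V) ≠ {a, b, y} := fun h => by
  have : y ∈ ({a, b, x} : Finset V) := h ▸ (by simp)
  simp only [mem_insert, mem_singleton] at this
  rcases this with h | h | h
  exacts [ay h.symm, hby h.symm, xy h.symm]

variable [Fintype V]

lemma add_three_le_sum (F : Finset V → ℕ) {a b x : V} (ab : a ≠ b) (ax : a ≠ x) (bx : b ≠ x) :
    F {a, b} + F {a, x} + F {b, x} ≤ ∑ p ∈ powersetCard 2 univ, F p := by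
  have h1 : ({a, b} : Finset V) ≠ {a, x} := fun h => by
    have : b ∈ ({a, x} : Finset V) := h ▸ (by simp)
    simp only [mem_insert, mem_singleton] at this
    exact this.elim (fun h => ab h.symm) bx
  have h2 : ({a, b} : Finset V) ≠ {b, x} := fun h => by
    have : a ∈ ({b, x} : Finset V) := h ▸ (by simp)
    simp only [mem_insert, mem_singleton] at this
    exact this.elim ab ax
  have h3 : ({a, x} : Finset V) ≠ {b, x} := fun h => by
    have : a ∈ ({b, x} : Finset V) := h ▸ (by simp)
    simp only [mem_insert, mem_singleton] at this
    exact this.elim ab ax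
  have hs : ({{a, b}, {a, x}, {b, x}} : Finset (Finset V)) ⊆ powersetCard 2 univ := by
    intro p
    simp only [mem_insert, mem_singleton, mem_powersetCard_univ]
    rintro (rfl | rfl | rfl)
    exacts [card_pair ab, card_pair ax, card_pair bx]
  refine le_trans (le_of_eq ?_) (sum_le_sum_of_subset hs)
  rw [sum_insert (by simp [h1, h2]), sum_pair h3, add_assoc]

lemma add_two_le_sum (F : Finset V → ℕ) {p q : Finset V} (hp : p.card = 2) (hq : q.card = 2)
    (hpq : p ≠ q) : F p + F q ≤ ∑ p ∈ powersetCard 2 univ, F p := by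
  have hs : ({p, q} : Finset (Finset V)) ⊆ powersetCard 2 univ := by
    intro t
    simp only [mem_insert, mem_singleton, mem_powersetCard_univ]
    rintro (rfl | rfl)
    exacts [hp, hq]
  rw [← sum_pair hpq]
  exact sum_le_sum_of_subset hs

/-- Charges in a component of three edges in which the third edge meets the first one in a
pair other than the common pair of the diamond. -/
lemma le_sum_of_path (hc : ∀ e ∈ G, e.card = 3) (hf : FourSpread G)
    {a b x y : V} (ab : a ≠ b) (ax : a ≠ x) (bx : b ≠ x) (ay : a ≠ y) (hby : b ≠ y) (xy : x ≠ y)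
    (me : {a, b, x} ∈ G) (mf : {a, b, y} ∈ G) (h0 : codeg G {x, y} = 0) {g : Finset V} (mg : g ∈ G)
    (ge : g ≠ {a, b, x}) (hg : {a, x} ⊆ g) :
    36 ≤ ∑ p ∈ powersetCard 2 univ, coverCharge G {a, b, x} p +
      ∑ p ∈ powersetCard 2 univ, missCharge G {a, b, x} p := by
  obtain ⟨w, wa, wx, rfl⟩ := exists_third (hc g mg) ax (hg (by simp)) (hg (by simp))
  have wb : w ≠ b := by
    rintro rfl
    exact ge (by rw [pair_comm])
  have hef := triple_ne ay hby xy
  have hfg : ({a, b, y} : Finset V) ≠ {a, x, w} := fun h => by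
    have : x ∈ ({a, b, y} : Finset V) := h ▸ (by simp)
    simp only [mem_insert, mem_singleton] at this
    rcases this with h | h | h
    exacts [ax h.symm, bx h.symm, xy h]
  have key : ∀ k ∈ G, ∀ u v, u ≠ v → u ∈ ({a, b, x, y, w} : Finset V) →
      v ∈ ({a, b, x, y, w} : Finset V) → {u, v} ⊆ k →
      k = {a, b, x} ∨ k = {a, b, y} ∨ k = {a, x, w} := by
    intro k mk u v huv hu hv hp
    exact mem_of_three_on_five hc hf me mf mg hef ge.symm hfg card_le_five
      (by intro t; simp only [mem_insert, mem_singleton]; rintro (h | h | h) <;> simp [h])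
      (by intro t; simp only [mem_insert, mem_singleton]; rintro (h | h | h) <;> simp [h])
      (by intro t; simp only [mem_insert, mem_singleton]; rintro (h | h | h) <;> simp [h])
      mk huv hu hv hp
  have niso : ¬ Isolated G {a, b, x} := fun h => by
    have := h _ mf hef.symm
    have := diamond_inter (x := x) (y := y) ab
    omega
  have cab : codeg G {a, b} = 2 := by
    refine codeg_eq_two me (by intro; simp; tauto) mf (by intro; simp; tauto) hef ?_
    intro k mk hp
    rcases key k mk a b ab (by simp) (by simp) hp with h | h | h
    · exact Or.inl h
    · exact Or.inr h
    · have : b ∈ ({a, x, w} : Finset V) := h ▸ hp (by simp)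
      simp only [mem_insert, mem_singleton] at this
      rcases this with h | h | h
      exacts [(ab h.symm).elim, (bx h).elim, (wb h.symm).elim]
  have cax : codeg G {a, x} = 2 := by
    refine codeg_eq_two me (by intro; simp; tauto) mg hg ge.symm ?_
    intro k mk hp
    rcases key k mk a x ax (by simp) (by simp) hp with h | h | h
    · exact Or.inl h
    · have : x ∈ ({a, b, y} : Finset V) := h ▸ hp (by simp)
      simp only [mem_insert, mem_singleton] at this
      rcases this with h | h | h
      exacts [(ax h.symm).elim, (bx h.symm).elim, (xy h).elim]
    · exact Or.inr h
  have cbx : codeg G {b, x} = 1 := by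
    refine codeg_eq_one me (by intro; simp; tauto) ?_
    intro k mk hp
    rcases key k mk b x bx (by simp) (by simp) hp with h | h | h
    · exact h
    · have : x ∈ ({a, b, y} : Finset V) := h ▸ hp (by simp)
      simp only [mem_insert, mem_singleton] at this
      rcases this with h | h | h
      exacts [(ax h.symm).elim, (bx h.symm).elim, (xy h).elim]
    · have : b ∈ ({a, x, w} : Finset V) := h ▸ hp (by simp)
      simp only [mem_insert, mem_singleton] at this
      rcases this with h | h | h
      exacts [(ab h.symm).elim, (bx h).elim, (wb h.symm).elim]
  have mxy : Missing G {a, b, x} {x, y} :=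
    ⟨_, mf, hef.symm, diamond_inter ab, symmDiff_diamond ax bx ay hby xy⟩
  have mbw : Missing G {a, b, x} {b, w} := by
    refine ⟨_, mg, ge, ?_, ?_⟩
    · rw [pair_comm b x]; exact diamond_inter ax
    · rw [pair_comm b x]; exact symmDiff_diamond ab bx.symm wa.symm wx.symm wb.symm
  have hne : ({x, y} : Finset V) ≠ {b, w} := fun h => by
    have : b ∈ ({x, y} : Finset V) := h ▸ (by simp)
    simp only [mem_insert, mem_singleton] at this
    exact this.elim bx hby
  have h1 := add_three_le_sum (coverCharge G {a, b, x}) ab ax bx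
  have h2 := add_two_le_sum (missCharge G {a, b, x}) (card_pair xy) (card_pair wb.symm) hne
  have e1 : coverCharge G {a, b, x} {a, b} = 7 := by
    rw [coverCharge, if_pos (by intro; simp; tauto), if_neg niso, cab]; rfl
  have e2 : coverCharge G {a, b, x} {a, x} = 7 := by
    rw [coverCharge, if_pos (by intro; simp; tauto), if_neg niso, cax]; rfl
  have e3 : coverCharge G {a, b, x} {b, x} = 14 := by
    rw [coverCharge, if_pos (by intro; simp; tauto), if_neg niso, cbx]; rfl
  have e4 : missCharge G {a, b, x} {x, y} = 7 := by
    rw [missCharge, if_pos mxy, h0]; rfl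
  have e5 : 1 ≤ missCharge G {a, b, x} {b, w} := by
    rw [missCharge, if_pos mbw]; split_ifs <;> omega
  omega

lemma le_sum_charge (hc : ∀ e ∈ G, e.card = 3) (hf : FourSpread G) (hk : ThreeSpread G)
    {e : Finset V} (me : e ∈ G) :
    36 ≤ ∑ p ∈ powersetCard 2 univ, (coverCharge G e p + missCharge G e p) := by
  rw [sum_add_distrib]
  by_cases hiso : Isolated G e
  · obtain ⟨a, b, x, ab, ax, bx, rfl⟩ := card_eq_three.1 (hc e me)
    have h1 := add_three_le_sum (coverCharge G {a, b, x}) ab ax bx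
    have e1 : coverCharge G {a, b, x} {a, b} = 12 := by
      rw [coverCharge, if_pos (by intro; simp; tauto), if_pos hiso]
    have e2 : coverCharge G {a, b, x} {a, x} = 12 := by
      rw [coverCharge, if_pos (by intro; simp; tauto), if_pos hiso]
    have e3 : coverCharge G {a, b, x} {b, x} = 12 := by
      rw [coverCharge, if_pos (by intro; simp; tauto), if_pos hiso]
    omega
  have niso := hiso
  simp only [Isolated, not_forall, not_lt] at hiso
  obtain ⟨f, mf, hfe, h2⟩ := hiso
  obtain ⟨a, b, x, y, rfl, rfl, ab, ax, bx, ay, hby, xy⟩ :=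
    exists_diamond (hc e me) (hc f mf) hfe.symm h2
  have mxy : Missing G {a, b, x} {x, y} :=
    ⟨_, mf, hfe, h2, symmDiff_diamond ax bx ay hby xy⟩
  have hcov := add_three_le_sum (coverCharge G {a, b, x}) ab ax bx
  have hmiss : missCharge G {a, b, x} {x, y} ≤
      ∑ p ∈ powersetCard 2 univ, missCharge G {a, b, x} p :=
    single_le_sum (f := missCharge G {a, b, x}) (fun _ _ => Nat.zero_le _)
      (mem_powersetCard_univ.2 (card_pair xy))
  have sab : ({a, b} : Finset V) ⊆ {a, b, x} := by intro; simp; tauto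
  have sax : ({a, x} : Finset V) ⊆ {a, b, x} := by intro; simp; tauto
  have sbx : ({b, x} : Finset V) ⊆ {a, b, x} := by intro; simp; tauto
  have xf : x ∉ ({a, b, y} : Finset V) := by simp [ax.symm, bx.symm, xy]
  rw [missCharge, if_pos mxy] at hmiss
  rw [coverCharge, coverCharge, coverCharge, if_pos sab, if_pos sax, if_pos sbx, if_neg niso,
    if_neg niso, if_neg niso] at hcov
  -- an edge covering the missing pair or a third edge on the common pair
  have hthird : ∀ h ∈ G, h ≠ {a, b, x} → h ≠ {a, b, y} →
      (∃ z, h ⊆ ({a, b, x, y, z} : Finset V)) → ∀ g ∈ G, ∀ u v, u ≠ v →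
      u ∈ ({a, b, x, y} : Finset V) → v ∈ ({a, b, x, y} : Finset V) → {u, v} ⊆ g →
      g = {a, b, x} ∨ g = {a, b, y} ∨ g = h := by
    rintro h mh he hf' ⟨z, hz⟩ g mg u v huv hu hv hp
    refine mem_of_three_on_five hc hf me mf mh hfe.symm he.symm hf'.symm
      (s := {a, b, x, y, z}) card_le_five ?_ ?_ hz mg huv ?_ ?_ hp
    · intro t; simp only [mem_insert, mem_singleton]; rintro (h | h | h) <;> simp [h]
    · intro t; simp only [mem_insert, mem_singleton]; rintro (h | h | h) <;> simp [h]
    · simp only [mem_insert, mem_singleton] at hu ⊢; tauto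
    · simp only [mem_insert, mem_singleton] at hv ⊢; tauto
  have hthree : ∀ h ∈ G, h ≠ {a, b, x} → h ≠ {a, b, y} → ¬ h ⊆ {a, b, x, y} := by
    intro h mh he hf' hs
    have := hk _ me _ mf h mh hfe.symm he.symm hf'.symm {a, b, x, y}
      (by intro t; simp only [mem_insert, mem_singleton]; rintro (h | h | h) <;> simp [h])
      (by intro t; simp only [mem_insert, mem_singleton]; rintro (h | h | h) <;> simp [h]) hs
    have := card_le_four (a := a) (b := b) (c := x) (d := y)
    omega
  by_cases h0 : codeg G {x, y} = 0
  · rw [if_pos h0] at hmiss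
    by_cases hgx : ∃ g ∈ G, g ≠ {a, b, x} ∧ {a, x} ⊆ g
    · obtain ⟨g, mg, ge, hg⟩ := hgx
      exact le_sum_of_path hc hf ab ax bx ay hby xy me mf h0 mg ge hg
    by_cases hgx' : ∃ g ∈ G, g ≠ {a, b, x} ∧ {b, x} ⊆ g
    · obtain ⟨g, mg, ge, hg⟩ := hgx'
      have := le_sum_of_path hc hf ab.symm bx ax hby ay xy (by rwa [insert_comm])
        (by rwa [insert_comm]) h0 mg (by rwa [insert_comm]) hg
      rwa [insert_comm b a] at this
    push Not at hgx hgx'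
    have cax : codeg G {a, x} = 1 :=
      codeg_eq_one me sax fun g mg hg => by_contra fun h => hgx g mg h hg
    have cbx : codeg G {b, x} = 1 :=
      codeg_eq_one me sbx fun g mg hg => by_contra fun h => hgx' g mg h hg
    rw [cax, cbx, if_pos rfl] at hcov
    split_ifs at hcov <;> omega
  · rw [if_neg h0] at hmiss
    obtain ⟨h, hh⟩ := card_pos.1 (Nat.pos_of_ne_zero h0)
    obtain ⟨mh, hxy⟩ := Finset.mem_filter.1 hh
    have he : h ≠ {a, b, x} := by
      rintro rfl
      have : y ∈ ({a, b, x} : Finset V) := hxy (by simp)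
      simp only [mem_insert, mem_singleton] at this
      rcases this with h | h | h
      exacts [ay h.symm, hby h.symm, xy h.symm]
    have hf' : h ≠ {a, b, y} := by
      rintro rfl
      exact xf (hxy (by simp))
    obtain ⟨z, -, -, hz⟩ := exists_third (hc h mh) xy (hxy (by simp)) (hxy (by simp))
    have hns := hthree h mh he hf'
    have za : a ∉ h := by
      intro ha
      apply hns
      rw [hz] at ha ⊢
      simp only [mem_insert, mem_singleton] at ha
      rcases ha with h | h | rfl
      · exact (ax h).elim
      · exact (ay h).elim
      · intro t; simp only [mem_insert, mem_singleton]; tauto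
    have zb : b ∉ h := by
      intro hb
      apply hns
      rw [hz] at hb ⊢
      simp only [mem_insert, mem_singleton] at hb
      rcases hb with h | h | rfl
      · exact (bx h).elim
      · exact (hby h).elim
      · intro t; simp only [mem_insert, mem_singleton]; tauto
    have key := hthird h mh he hf'
      ⟨z, by rw [hz]; intro t; simp only [mem_insert, mem_singleton]; tauto⟩
    have cab : codeg G {a, b} = 2 := by
      refine codeg_eq_two me sab mf (by intro; simp; tauto) hfe.symm fun g mg hp => ?_
      rcases key g mg a b ab (by simp) (by simp) hp with h | h | h
      exacts [Or.inl h, Or.inr h, (za (h ▸ hp (by simp))).elim]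
    have cax : codeg G {a, x} = 1 := by
      refine codeg_eq_one me sax fun g mg hp => ?_
      rcases key g mg a x ax (by simp) (by simp) hp with h | h | h
      exacts [h, (xf (h ▸ hp (by simp))).elim, (za (h ▸ hp (by simp))).elim]
    have cbx : codeg G {b, x} = 1 := by
      refine codeg_eq_one me sbx fun g mg hp => ?_
      rcases key g mg b x bx (by simp) (by simp) hp with h | h | h
      exacts [h, (xf (h ▸ hp (by simp))).elim, (zb (h ▸ hp (by simp))).elim]
    rw [cab, cax, cbx, if_pos rfl, if_neg (by norm_num), if_pos rfl] at hcov
    omega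

lemma card_le_of_spread (hc : ∀ e ∈ G, e.card = 3) (hf : FourSpread G) (hk : ThreeSpread G) :
    36 * G.card ≤ 14 * (Fintype.card V).choose 2 := by
  have h1 : 36 * G.card ≤
      ∑ e ∈ G, ∑ p ∈ powersetCard 2 univ, (coverCharge G e p + missCharge G e p) := by
    rw [mul_comm, ← smul_eq_mul]
    exact card_nsmul_le_sum _ _ _ fun e me => le_sum_charge hc hf hk me
  rw [sum_comm] at h1
  refine h1.trans ?_
  rw [mul_comm 14, ← card_univ, ← card_powersetCard, ← smul_eq_mul]
  exact sum_le_card_nsmul _ _ _ fun p hp => sum_charge_le hc hf hk (mem_powersetCard_univ.1 hp)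

lemma card_le_of_isFree (hc : ∀ e ∈ G, e.card = 3) (h : IsFree G 6 4) :
    36 * G.card ≤ 14 * (Fintype.card V).choose 2 + 36 * Fintype.card V := by
  have hf := h.fourSpread
  have h1 := card_le_of_spread (fun e he => hc e (sdiff_subset he)) (hf.mono sdiff_subset)
    (threeSpread_sdiff G)
  have h2 := card_denseEdges_le hc hf
  have hsub : denseEdges G ⊆ G := filter_subset _ _
  have h3 := card_sdiff_add_card_eq_card hsub
  omega

end EdgeCharge

lemma exNum_upper (n : ℕ) : (exNum 3 n 6 4 : ℝ) ≤ 7 / 36 * (n : ℝ) ^ 2 + n := by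
  have h : 36 * exNum 3 n 6 4 ≤ 14 * n.choose 2 + 36 * n := by
    have hne : {m : ℕ | ∃ G : Finset (Finset (Fin n)),
        (∀ e ∈ G, e.card = 3) ∧ IsFree G 6 4 ∧ G.card = m}.Nonempty :=
      ⟨0, ∅, by simp, good_empty.isFree, rfl⟩
    obtain ⟨G, hc, hf, hG⟩ := Nat.sSup_mem hne (bddAbove_exNum 3 n 6 4)
    change G.card = exNum 3 n 6 4 at hG
    rw [← hG]
    simpa using card_le_of_isFree hc hf
  have hr : (36 : ℝ) * exNum 3 n 6 4 ≤ 14 * (n.choose 2 : ℕ) + 36 * n := by exact_mod_cast h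
  rw [Nat.cast_choose_two] at hr
  have : (0 : ℝ) ≤ n := Nat.cast_nonneg n
  nlinarith

/-- The limit of `n⁻² f⁽³⁾(n; 6, 4)` exists and equals `7/36`. -/
theorem brown_erdos_sos_64 :
    Tendsto (fun n : ℕ => (exNum 3 n 6 4 : ℝ) / (n : ℝ) ^ 2) atTop (nhds (7 / 36)) := by
  rw [Metric.tendsto_nhds]
  intro ε hε
  obtain ⟨n₀, hn₀⟩ := exists_nat_gt (1 / ε)
  filter_upwards [exNum_lower (half_pos hε), eventually_gt_atTop n₀] with n hl hn
  have hn' : (n₀ : ℝ) < n := by exact_mod_cast hn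
  have hn0 : (0 : ℝ) < n := lt_of_le_of_lt (Nat.cast_nonneg _) hn'
  have hsq : (0 : ℝ) < (n : ℝ) ^ 2 := by positivity
  have hεn : 1 < ε * n := by
    rw [div_lt_iff₀ hε] at hn₀
    nlinarith
  rw [Real.dist_eq, abs_lt]
  constructor
  · rw [lt_sub_iff_add_lt, lt_div_iff₀ hsq]
    nlinarith
  · rw [sub_lt_iff_lt_add, div_lt_iff₀ hsq]
    have := exNum_upper n
    nlinarith
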